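/- arXiv:2403.02993 — 2 statements merged into one kernel-verified Lean document; each statement's English description precedes it below -/
import Mathlib

section
/- Let d ≥ 1 be an integer and let X be a random vector in ℝ^d whose distribution is a multivariate Gaussian with mean vector m ∈ ℝ^d and covariance matrix Σ (a d×d real symmetric positive semidefinite matrix). Then for every δ ∈ (0, 1), with probability at least 1 − δ one has ‖X − m‖² ≤ ω · λ_max(Σ), where ω = d + 2(√d + 1)·ln(1/δ). -/
open Matrix MeasureTheory ProbabilityTheory

open Filter Topology in
lemma aux_tail (k : ℝ) (hk : 0 < k) (f T : ℝ → ℝ) (hf0 : ∀ x, 0 < x → 0 ≤ f x)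
    (hf : ∀ x, 0 < x → HasDerivAt f (f x * ((k - 1) / x - 1)) x)
    (hT : ∀ x, 0 < x → HasDerivAt T (-f x) x)
    (hfl : Tendsto f atTop (𝓝 0)) (hTl : Tendsto T atTop (𝓝 0))
    (x : ℝ) (hx : k ≤ x) : T x ≤ (Real.sqrt (2 * k) + 1) * f x := by
  obtain ⟨a, ha, hak⟩ : ∃ a : ℝ, 0 < a ∧ k = 2 * a ^ 2 := by
    refine ⟨Real.sqrt (k / 2), by positivity, ?_⟩
    rw [Real.sq_sqrt (by positivity)]; ring
  have hs : Real.sqrt (2 * k) = 2 * a := by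
    rw [hak, show 2 * (2 * a ^ 2) = (2 * a) ^ 2 by ring, Real.sqrt_sq (by positivity)]
  rw [hs]
  -- far region
  have far : ∀ y, k + 2 * a ≤ y → T y ≤ (a + 1) * f y := by
    intro y hy
    have hmono : MonotoneOn (fun y => T y - (a + 1) * f y) (Set.Ici (k + 2 * a)) := by
      apply monotoneOn_of_hasDerivWithinAt_nonneg (convex_Ici _)
        (f' := fun y => -f y - (a + 1) * (f y * ((k - 1) / y - 1)))
      · intro z hz
        have hz0 : 0 < z := by have := Set.mem_Ici.1 hz; linarith
        exact ((hT z hz0).sub ((hf z hz0).const_mul _)).continuousAt.continuousWithinAt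
      · intro z hz
        rw [interior_Ici] at hz
        have hz0 : 0 < z := by have := Set.mem_Ioi.1 hz; linarith
        exact ((hT z hz0).sub ((hf z hz0).const_mul _)).hasDerivWithinAt
      · intro z hz
        rw [interior_Ici] at hz
        have hz1 := Set.mem_Ioi.1 hz
        have hz0 : 0 < z := by linarith
        have : -f z - (a + 1) * (f z * ((k - 1) / z - 1)) =
          f z * (((a + 1) * (z - k + 1) - z) / z) := by field_simp; ring
        rw [this]
        refine mul_nonneg (hf0 z hz0) (div_nonneg ?_ hz0.le)
        rw [hak] at hz1 ⊢
        nlinarith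
    have hlim : Tendsto (fun y => T y - (a + 1) * f y) atTop (𝓝 0) := by
      simpa using hTl.sub (hfl.const_mul (a + 1))
    have : T y - (a + 1) * f y ≤ 0 := by
      refine ge_of_tendsto hlim ?_
      filter_upwards [eventually_ge_atTop y] with z hz
      exact hmono hy (le_trans hy hz) hz
    linarith
  rcases le_total (k + 2 * a) x with h | h
  · have := far x h
    have := hf0 x (by linarith)
    nlinarith
  · have hM : ∀ y, HasDerivAt (fun y : ℝ => a + 1 + (k + 2 * a - y) ^ 2 / (4 * a))
        (-(k + 2 * a - y) / (2 * a)) y := by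
      intro y
      have h1 : HasDerivAt (fun y : ℝ => k + 2 * a - y) (-1) y := by
        simpa using (hasDerivAt_id y).const_sub (k + 2 * a)
      have := ((h1.pow 2).div_const (4 * a)).const_add (a + 1)
      refine this.congr_deriv ?_
      field_simp
      ring
    have hmono : MonotoneOn (fun y => T y - (a + 1 + (k + 2 * a - y) ^ 2 / (4 * a)) * f y)
        (Set.Icc k (k + 2 * a)) := by
      apply monotoneOn_of_hasDerivWithinAt_nonneg (convex_Icc _ _)
        (f' := fun y => -f y - ((-(k + 2 * a - y) / (2 * a)) * f y +
          (a + 1 + (k + 2 * a - y) ^ 2 / (4 * a)) * (f y * ((k - 1) / y - 1))))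
      · intro z hz
        have hz0 : 0 < z := lt_of_lt_of_le hk hz.1
        exact ((hT z hz0).sub ((hM z).mul (hf z hz0))).continuousAt.continuousWithinAt
      · intro z hz
        rw [interior_Icc] at hz
        have hz0 : 0 < z := lt_trans hk hz.1
        exact ((hT z hz0).sub ((hM z).mul (hf z hz0))).hasDerivWithinAt
      · intro z hz
        rw [interior_Icc] at hz
        have hz0 : 0 < z := lt_trans hk hz.1
        obtain ⟨s, rfl⟩ : ∃ s, z = k + s := ⟨z - k, by ring⟩
        have hs0 : 0 < s := by linarith [hz.1]
        have hs1 : s < 2 * a := by linarith [hz.2]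
        have : -f (k + s) - ((-(k + 2 * a - (k + s)) / (2 * a)) * f (k + s) +
          (a + 1 + (k + 2 * a - (k + s)) ^ 2 / (4 * a)) * (f (k + s) * ((k - 1) / (k + s) - 1))) =
          f (k + s) * ((s * (s - 2 * a) ^ 2 - s ^ 2 + 8 * a ^ 2 + 4 * a) / (4 * a * (k + s))) := by
          rw [hak] at hz0 ⊢
          field_simp
          ring
        rw [this]
        refine mul_nonneg (hf0 _ hz0) (div_nonneg ?_ (by positivity))
        nlinarith [mul_nonneg hs0.le (sq_nonneg (s - 2 * a))]
    have h1 := hmono ⟨hx, h⟩ ⟨by linarith, le_rfl⟩ h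
    have h2 := far _ le_rfl
    simp only [sub_self] at h1
    have h3 : T x ≤ (a + 1 + (k + 2 * a - x) ^ 2 / (4 * a)) * f x := by
      norm_num at h1
      linarith
    refine h3.trans (mul_le_mul_of_nonneg_right ?_ (hf0 x (by linarith)))
    have : (k + 2 * a - x) ^ 2 / (4 * a) ≤ a := by
      rw [div_le_iff₀ (by positivity)]
      nlinarith
    linarith

open Filter Topology in
lemma aux_tail2 (k : ℝ) (hk : 0 < k) (f T : ℝ → ℝ) (hf0 : ∀ x, 0 < x → 0 ≤ f x)
    (hf : ∀ x, 0 < x → HasDerivAt f (f x * ((k - 1) / x - 1)) x)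
    (hT : ∀ x, 0 < x → HasDerivAt T (-f x) x)
    (hfl : Tendsto f atTop (𝓝 0)) (hTl : Tendsto T atTop (𝓝 0))
    (t : ℝ) (ht : 0 ≤ t) :
    Real.exp t * T (k + (Real.sqrt (2 * k) + 1) * t) ≤ T k := by
  set C := Real.sqrt (2 * k) + 1 with hC
  have hC0 : 0 < C := by positivity
  have hd : ∀ s, 0 ≤ s → HasDerivAt (fun s => Real.exp s * T (k + C * s))
      (Real.exp s * T (k + C * s) + Real.exp s * (-f (k + C * s) * C)) s := by
    intro s hs
    have h1 : HasDerivAt (fun s : ℝ => k + C * s) C s := by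
      simpa using ((hasDerivAt_id s).const_mul C).const_add k
    have h2 := (hT (k + C * s) (by positivity)).comp s h1
    exact (Real.hasDerivAt_exp s).mul h2
  have hanti : AntitoneOn (fun s => Real.exp s * T (k + C * s)) (Set.Ici 0) := by
    apply antitoneOn_of_hasDerivWithinAt_nonpos (convex_Ici _)
      (f' := fun s => Real.exp s * T (k + C * s) + Real.exp s * (-f (k + C * s) * C))
    · intro s hs
      exact (hd s hs).continuousAt.continuousWithinAt
    · intro s hs
      rw [interior_Ici] at hs
      exact (hd s (le_of_lt hs)).hasDerivWithinAt
    · intro s hs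
      rw [interior_Ici] at hs
      have hs0 : 0 < s := hs
      have := aux_tail k hk f T hf0 hf hT hfl hTl (k + C * s) (by nlinarith)
      rw [← mul_add]
      refine mul_nonpos_of_nonneg_of_nonpos (Real.exp_pos _).le ?_
      rw [← hC] at this
      linarith
  have := hanti (Set.mem_Ici.2 le_rfl) (Set.mem_Ici.2 ht) ht
  simpa using this

open Filter Topology in
lemma aux_radial (d : ℕ) (hd : 1 ≤ d) (t : ℝ) (ht : 0 ≤ t) :
    (1 - Real.exp (-t)) * ∫ r in Set.Ioi (0 : ℝ), r ^ (d - 1) * Real.exp (-r ^ 2 / 2) ≤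
      ∫ r in (0 : ℝ)..Real.sqrt (d + 2 * (Real.sqrt d + 1) * t),
        r ^ (d - 1) * Real.exp (-r ^ 2 / 2) := by
  set φ : ℝ → ℝ := fun r => r ^ (d - 1) * Real.exp (-r ^ 2 / 2) with hφ
  have hφc : Continuous φ := by fun_prop
  have hφi : IntegrableOn φ (Set.Ioi 0) := by
    have := integrableOn_rpow_mul_exp_neg_mul_sq (b := 1 / 2) (by norm_num) (s := ((d - 1 : ℕ) : ℝ))
      (by have : (0 : ℝ) ≤ ((d - 1 : ℕ) : ℝ) := by positivity
          linarith)
    refine this.congr_fun ?_ measurableSet_Ioi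
    intro r _
    simp only [hφ, Real.rpow_natCast]
    congr 2
    ring
  set I := ∫ r in Set.Ioi (0 : ℝ), φ r with hI
  set k : ℝ := d / 2 with hkdef
  have hd' : (1 : ℝ) ≤ d := by exact_mod_cast hd
  have hk : 0 < k := by positivity
  set T : ℝ → ℝ := fun x => I - ∫ r in (0 : ℝ)..Real.sqrt (2 * x), φ r with hTdef
  set f : ℝ → ℝ := fun x => (2 * x) ^ (k - 1) * Real.exp (-x) with hfdef
  have h2k : 2 * k = d := by rw [hkdef]; ring
  have key := aux_tail2 k hk f T ?_ ?_ ?_ ?_ ?_ t ht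
  · have hTk : T k ≤ I := by
      have : 0 ≤ ∫ r in (0 : ℝ)..Real.sqrt (2 * k), φ r := by
        apply intervalIntegral.integral_nonneg (Real.sqrt_nonneg _)
        intro r hr
        have := hr.1
        positivity
      simp only [hTdef]; linarith
    have h1 : T (k + (Real.sqrt (2 * k) + 1) * t) ≤ Real.exp (-t) * I := by
      rw [Real.exp_neg, ← div_eq_inv_mul, le_div_iff₀ (Real.exp_pos t), mul_comm]
      linarith
    have h2 : 2 * (k + (Real.sqrt (2 * k) + 1) * t) = d + 2 * (Real.sqrt d + 1) * t := by
      rw [mul_add, h2k]; ring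
    simp only [hTdef] at h1
    rw [h2] at h1
    linarith
  · intro x hx
    positivity
  · intro x hx
    have h1 : HasDerivAt (fun x : ℝ => 2 * x) 2 x := by
      simpa using (hasDerivAt_id x).const_mul 2
    have h2 := h1.rpow_const (p := k - 1) (Or.inl (by positivity))
    have h3 : HasDerivAt (fun x : ℝ => Real.exp (-x)) (-Real.exp (-x)) x := by
      simpa using (hasDerivAt_neg x).exp
    refine (h2.mul h3).congr_deriv ?_
    simp only [hfdef]
    rw [Real.rpow_sub_one (by positivity) (k - 1)]
    field_simp
    ring
  · intro x hx
    have h1 : HasDerivAt (fun x : ℝ => 2 * x) 2 x := by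
      simpa using (hasDerivAt_id x).const_mul 2
    have h2 := h1.sqrt (by positivity)
    have h3 := (hφc.integral_hasStrictDerivAt 0 (Real.sqrt (2 * x))).hasDerivAt
    have h4 := (h3.comp x h2).const_sub I
    refine h4.congr_deriv ?_
    simp only [hfdef, hφ]
    rw [Real.sq_sqrt (by positivity), Real.sqrt_eq_rpow, ← Real.rpow_natCast,
      ← Real.rpow_mul (by positivity)]
    have h5 : (2 * x) ^ (1 / 2 * ((d - 1 : ℕ) : ℝ)) = (2 * x) ^ (k - 1) * (2 * x) ^ (1 / 2 : ℝ) := by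
      rw [← Real.rpow_add (by positivity)]
      congr 1
      rw [hkdef]; push_cast [hd]; ring
    rw [h5]
    have h6 : (0 : ℝ) < (2 * x) ^ (1 / 2 : ℝ) := by positivity
    rw [show -(2 * x) / 2 = -x by ring]
    field_simp
  · have h1 := (tendsto_rpow_mul_exp_neg_mul_atTop_nhds_zero (k - 1) 1 one_pos).const_mul
      ((2 : ℝ) ^ (k - 1))
    rw [mul_zero] at h1
    refine h1.congr' ?_
    filter_upwards [eventually_ge_atTop 0] with x hx
    simp only [hfdef]
    rw [Real.mul_rpow (by norm_num) hx]
    ring_nf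
  · have h1 : Tendsto (fun x : ℝ => Real.sqrt (2 * x)) atTop atTop :=
      Real.tendsto_sqrt_atTop.comp (tendsto_id.const_mul_atTop two_pos)
    have h2 := (intervalIntegral_tendsto_integral_Ioi 0 hφi h1).const_sub I
    rw [← hI, sub_self] at h2
    exact h2

lemma aux_density (d : ℕ) :
    stdGaussian (EuclideanSpace ℝ (Fin d)) = (volume : Measure (EuclideanSpace ℝ (Fin d))).withDensity
      (fun x => ENNReal.ofReal ((2 * Real.pi) ^ (-(d : ℝ) / 2) * Real.exp (-‖x‖ ^ 2 / 2))) := by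
  have hint : Integrable (fun x : EuclideanSpace ℝ (Fin d) =>
      (2 * Real.pi) ^ (-(d : ℝ) / 2) * Real.exp (-‖x‖ ^ 2 / 2)) := by
    have := (GaussianFourier.integrable_cexp_neg_mul_sq_norm_add (b := 1 / 2) (by norm_num) 0
      (0 : EuclideanSpace ℝ (Fin d))).re
    refine (this.const_mul ((2 * Real.pi) ^ (-(d : ℝ) / 2))).congr (Filter.Eventually.of_forall fun x => ?_)
    simp only [zero_mul, add_zero]
    congr 1
    have : (-(1 / 2 : ℂ) * (‖x‖ : ℂ) ^ 2) = ((-‖x‖ ^ 2 / 2 : ℝ) : ℂ) := by push_cast; ring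
    rw [this]
    exact Complex.exp_ofReal_re _
  have : IsFiniteMeasure ((volume : Measure (EuclideanSpace ℝ (Fin d))).withDensity
      (fun x => ENNReal.ofReal ((2 * Real.pi) ^ (-(d : ℝ) / 2) * Real.exp (-‖x‖ ^ 2 / 2)))) :=
    isFiniteMeasure_withDensity_ofReal hint.2
  apply Measure.ext_of_charFun
  ext t
  rw [charFun_stdGaussian, charFun_apply]
  rw [integral_withDensity_eq_integral_toReal_smul (by fun_prop) (by simp)]
  have h := GaussianFourier.integral_cexp_neg_mul_sq_norm_add (b := 1 / 2) (by norm_num) Complex.I t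
  have e : ∀ x : EuclideanSpace ℝ (Fin d),
      (ENNReal.ofReal ((2 * Real.pi) ^ (-(d : ℝ) / 2) * Real.exp (-‖x‖ ^ 2 / 2))).toReal •
        Complex.exp (inner ℝ x t * Complex.I) =
      (((2 * Real.pi) ^ (-(d : ℝ) / 2) : ℝ) : ℂ) *
        Complex.exp (-(1 / 2) * ‖x‖ ^ 2 + Complex.I * inner ℝ t x) := by
    intro x
    rw [ENNReal.toReal_ofReal (by positivity), Complex.real_smul, Complex.ofReal_mul, mul_assoc,
      Complex.ofReal_exp, ← Complex.exp_add, real_inner_comm]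
    congr 2
    push_cast
    ring
  simp_rw [e]
  rw [integral_const_mul, h]
  have h2 : ((Real.pi : ℂ) / (1 / 2)) ^ ((Module.finrank ℝ (EuclideanSpace ℝ (Fin d)) : ℂ) / 2) =
      (((2 * Real.pi) ^ ((d : ℝ) / 2) : ℝ) : ℂ) := by
    rw [Complex.ofReal_cpow (by positivity)]
    simp
    congr 1
    ring
  rw [h2, ← mul_assoc, ← Complex.ofReal_mul, ← Real.rpow_add (by positivity)]
  have : -(d : ℝ) / 2 + d / 2 = 0 := by ring
  rw [this, Real.rpow_zero, Complex.I_sq]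
  simp
  congr 1
  ring

lemma aux_std (d : ℕ) (hd : 1 ≤ d) (t : ℝ) (ht : 0 ≤ t) :
    1 - Real.exp (-t) ≤ (stdGaussian (EuclideanSpace ℝ (Fin d))).real
      {z | ‖z‖ ≤ Real.sqrt (d + 2 * (Real.sqrt d + 1) * t)} := by
  have : Nonempty (Fin d) := ⟨⟨0, hd⟩⟩
  set R := Real.sqrt (d + 2 * (Real.sqrt d + 1) * t) with hR
  have hR0 : 0 ≤ R := Real.sqrt_nonneg _
  set c : ℝ := (2 * Real.pi) ^ (-(d : ℝ) / 2) with hc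
  set K : ℝ := c * (d * (volume : Measure (EuclideanSpace ℝ (Fin d))).real (Metric.ball 0 1)) with hK
  have hK0 : 0 ≤ K := by positivity
  have gen : ∀ s : Set ℝ, MeasurableSet s →
      (stdGaussian (EuclideanSpace ℝ (Fin d))).real {z | ‖z‖ ∈ s} =
      K * ∫ r in Set.Ioi (0 : ℝ), s.indicator (fun r => r ^ (d - 1) * Real.exp (-r ^ 2 / 2)) r := by
    intro s hs
    have hms : MeasurableSet {z : EuclideanSpace ℝ (Fin d) | ‖z‖ ∈ s} := measurable_norm hs
    have hI := integral_fun_norm_addHaar (volume : Measure (EuclideanSpace ℝ (Fin d)))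
      (s.indicator (fun r => c * Real.exp (-r ^ 2 / 2)))
    have h1 : (stdGaussian (EuclideanSpace ℝ (Fin d))).real {z | ‖z‖ ∈ s} =
        ∫ x : EuclideanSpace ℝ (Fin d), s.indicator (fun r => c * Real.exp (-r ^ 2 / 2)) ‖x‖ := by
      rw [integral_eq_lintegral_of_nonneg_ae]
      · rw [Measure.real, aux_density, withDensity_apply _ hms, ← lintegral_indicator hms]
        congr 2
        ext x
        by_cases hx : ‖x‖ ∈ s <;> simp [Set.indicator, hx, hc]
      · refine Filter.Eventually.of_forall fun x => ?_
        apply Set.indicator_nonneg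
        intro r _
        positivity
      · apply Measurable.aestronglyMeasurable
        exact (Measurable.indicator (by fun_prop) hs).comp measurable_norm
    rw [h1, hI, hK]
    simp only [finrank_euclideanSpace, Fintype.card_fin, nsmul_eq_mul, smul_eq_mul]
    have : ∀ y : ℝ, y ^ (d - 1) * s.indicator (fun r => c * Real.exp (-r ^ 2 / 2)) y =
        c * s.indicator (fun r => r ^ (d - 1) * Real.exp (-r ^ 2 / 2)) y := by
      intro y
      by_cases hy : y ∈ s <;> simp [hy]
      ring
    simp_rw [this]
    rw [integral_const_mul]
    ring
  have htot := gen Set.univ MeasurableSet.univ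
  simp only [Set.mem_univ, Set.ofPred_true, probReal_univ, Set.indicator_univ] at htot
  have hA := gen (Set.Iic R) measurableSet_Iic
  rw [setIntegral_indicator measurableSet_Iic, Set.Ioi_inter_Iic,
    ← intervalIntegral.integral_of_le hR0] at hA
  simp only [Set.mem_Iic] at hA
  rw [hA]
  have := mul_le_mul_of_nonneg_left (aux_radial d hd t ht) hK0
  have h2 : K * ((1 - Real.exp (-t)) *
      ∫ r in Set.Ioi (0 : ℝ), r ^ (d - 1) * Real.exp (-r ^ 2 / 2)) = 1 - Real.exp (-t) := by
    rw [mul_left_comm, ← htot, mul_one]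
  rw [h2] at this
  exact this

open scoped MatrixOrder in
lemma aux_rayleigh (d : ℕ) (S : Matrix (Fin d) (Fin d) ℝ) (hS : S.PosSemidef)
    (z : EuclideanSpace ℝ (Fin d)) :
    ‖toEuclideanCLM (𝕜 := ℝ) (CFC.sqrt S) z‖ ^ 2 ≤ (⨆ i, hS.1.eigenvalues i) * ‖z‖ ^ 2 := by
  have hsa : IsSelfAdjoint (toEuclideanCLM (𝕜 := ℝ) (CFC.sqrt S)) :=
    (CFC.sqrt_nonneg S).isSelfAdjoint.map _
  have hsa2 : IsSelfAdjoint (toEuclideanCLM (𝕜 := ℝ) S) := IsSelfAdjoint.map hS.1 _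
  have h1 : ‖toEuclideanCLM (𝕜 := ℝ) (CFC.sqrt S) z‖ ^ 2 = inner ℝ z (toEuclideanCLM (𝕜 := ℝ) S z) := by
    rw [← real_inner_self_eq_norm_sq]
    nth_rewrite 1 [← hsa.adjoint_eq]
    rw [ContinuousLinearMap.adjoint_inner_left, ← ContinuousLinearMap.comp_apply,
      ← ContinuousLinearMap.mul_def, ← map_mul, CFC.sqrt_mul_sqrt_self _ hS.nonneg]
  set b := hS.1.eigenvectorBasis with hb
  rw [h1, ← b.sum_inner_mul_inner, ← b.sum_sq_norm_inner_right z, Finset.mul_sum]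
  refine Finset.sum_le_sum fun i _ => ?_
  have h2 : toEuclideanCLM (𝕜 := ℝ) S (b i) = hS.1.eigenvalues i • b i := by
    have := hS.1.mulVec_eigenvectorBasis i
    ext j
    exact congrFun this j
  have h3 : inner ℝ (b i) (toEuclideanCLM (𝕜 := ℝ) S z) = hS.1.eigenvalues i * inner ℝ (b i) z := by
    rw [← ContinuousLinearMap.adjoint_inner_left, hsa2.adjoint_eq, h2, real_inner_smul_left]
  rw [h3, real_inner_comm]
  have h4 : hS.1.eigenvalues i ≤ ⨆ i, hS.1.eigenvalues i :=
    le_ciSup (Set.finite_range _).bddAbove i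
  rw [Real.norm_eq_abs, sq_abs]
  nlinarith [sq_nonneg (inner ℝ (b i) z)]

lemma aux_law (d : ℕ) {Ω : Type} [MeasurableSpace Ω] (P : Measure Ω) [IsProbabilityMeasure P]
    (X : Ω → EuclideanSpace ℝ (Fin d)) (m : EuclideanSpace ℝ (Fin d))
    (Cov : Matrix (Fin d) (Fin d) ℝ) (hCov : Cov.PosSemidef)
    (hX : ∀ u : Fin d → ℝ,
      P.map (fun w => ∑ i, u i * X w i) =
        gaussianReal (∑ i, u i * m i)
          (Real.toNNReal (∑ i, ∑ j, u i * Cov i j * u j))) :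
    AEMeasurable X P ∧ P.map X = multivariateGaussian m Cov := by
  have hm : ∀ u : Fin d → ℝ, AEMeasurable (fun w => ∑ i, u i * X w i) P := by
    intro u
    apply AEMeasurable.of_map_ne_zero
    rw [hX u]
    exact IsProbabilityMeasure.ne_zero _
  have hXm : AEMeasurable X P := by
    have h1 : AEMeasurable (fun w => (WithLp.ofLp (X w))) P := by
      rw [aemeasurable_pi_iff]
      intro i
      have := hm (Pi.single i 1)
      simpa [Pi.single_apply] using this
    exact (MeasurableEquiv.toLp 2 (Fin d → ℝ)).measurable.comp_aemeasurable h1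
  refine ⟨hXm, ?_⟩
  have : IsProbabilityMeasure (P.map X) := Measure.isProbabilityMeasure_map hXm
  apply Measure.ext_of_charFun
  ext u
  rw [charFun_multivariateGaussian hCov, charFun_apply, integral_map hXm (by fun_prop)]
  have h1 := congrArg (fun ν => charFun ν 1) (hX u)
  simp only [charFun_gaussianReal] at h1
  rw [charFun_apply, integral_map (hm u) (by fun_prop)] at h1
  have hq : ∑ i, ∑ j, u i * Cov i j * u j = u ⬝ᵥ Cov *ᵥ u := by
    simp [dotProduct, mulVec, Finset.mul_sum, mul_assoc]
  have hq0 : 0 ≤ (u ⬝ᵥ Cov *ᵥ u : ℝ) := by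
    simpa using hCov.dotProduct_mulVec_nonneg (WithLp.ofLp u)
  rw [hq] at h1
  have h2 : (inner ℝ u m : ℝ) = ∑ i, u i * m i := by
    simp [PiLp.inner_apply, mul_comm]
  rw [h2]
  have h3 : ∀ w, (inner ℝ (X w) u : ℝ) = inner ℝ (∑ i, u i * X w i) (1 : ℝ) := by
    intro w
    simp [PiLp.inner_apply]
  simp_rw [h3]
  rw [h1, Real.coe_toNNReal _ hq0]
  simp

/-- Gaussian concentration bound (Lemma B.1 / Theorem 1 of ZoRD): if `X` is a multivariate
Gaussian random vector in `ℝ^d` with mean `m` and covariance matrix `Cov` (characterized by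
every linear functional `u ↦ ⟨u, X⟩` being a real Gaussian with mean `⟨u, m⟩` and variance
`uᵀ Cov u`), then for every `δ ∈ (0,1)`, with probability at least `1 − δ`,
`‖X − m‖² ≤ ω · λ_max(Cov)` where `ω = d + 2(√d + 1)·ln(1/δ)`. -/
theorem gaussian_norm_sq_concentration
    (d : ℕ) (hd : 1 ≤ d)
    {Ω : Type} [MeasurableSpace Ω] (P : Measure Ω) [IsProbabilityMeasure P]
    (X : Ω → EuclideanSpace ℝ (Fin d)) (m : EuclideanSpace ℝ (Fin d))
    (Cov : Matrix (Fin d) (Fin d) ℝ) (hCov : Cov.PosSemidef)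
    (hX : ∀ u : Fin d → ℝ,
      P.map (fun w => ∑ i, u i * X w i) =
        gaussianReal (∑ i, u i * m i)
          (Real.toNNReal (∑ i, ∑ j, u i * Cov i j * u j)))
    (δ : ℝ) (hδ : δ ∈ Set.Ioo (0 : ℝ) 1) :
    ENNReal.ofReal (1 - δ) ≤
      P {w | ‖X w - m‖ ^ 2 ≤
        ((d : ℝ) + 2 * (Real.sqrt d + 1) * Real.log (1 / δ)) *
          (⨆ i, hCov.1.eigenvalues i)} := by
  obtain ⟨hXm, hlaw⟩ := aux_law d P X m Cov hCov hX
  have hδ0 : 0 < δ := hδ.1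
  set t := Real.log (1 / δ) with ht
  have ht0 : 0 ≤ t := Real.log_nonneg (by rw [le_div_iff₀ hδ0]; linarith [hδ.2])
  have het : Real.exp (-t) = δ := by
    rw [ht, one_div, Real.log_inv, neg_neg, Real.exp_log hδ0]
  set ω : ℝ := (d : ℝ) + 2 * (Real.sqrt d + 1) * t with hω
  have hω0 : 0 ≤ ω := by positivity
  set lam := ⨆ i, hCov.1.eigenvalues i with hlam
  have hlam0 : 0 ≤ lam := Real.iSup_nonneg fun i => hCov.eigenvalues_nonneg i
  have hstd := aux_std d hd t ht0
  rw [het, ← hω] at hstd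
  have hms : MeasurableSet {x : EuclideanSpace ℝ (Fin d) | ‖x - m‖ ^ 2 ≤ ω * lam} :=
    measurableSet_le (by fun_prop) (by fun_prop)
  have hP : P {w | ‖X w - m‖ ^ 2 ≤ ω * lam} =
      P.map X {x | ‖x - m‖ ^ 2 ≤ ω * lam} := by
    rw [Measure.map_apply_of_aemeasurable hXm hms]
    rfl
  rw [hP, hlaw, multivariateGaussian, Measure.map_apply (by fun_prop) hms]
  have h1 : ENNReal.ofReal (1 - δ) ≤
      stdGaussian (EuclideanSpace ℝ (Fin d)) {z | ‖z‖ ≤ Real.sqrt ω} := by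
    rw [← ofReal_measureReal]
    exact ENNReal.ofReal_le_ofReal hstd
  refine h1.trans (measure_mono ?_)
  intro z hz
  have hz1 : ‖z‖ ^ 2 ≤ ω := by
    rw [← Real.sq_sqrt hω0]
    exact pow_le_pow_left₀ (norm_nonneg _) hz 2
  simp only [Set.mem_preimage, Set.mem_ofPred_eq, add_sub_cancel_left]
  calc _ ≤ lam * ‖z‖ ^ 2 := aux_rayleigh d Cov hCov z
    _ ≤ lam * ω := mul_le_mul_of_nonneg_left hz1 hlam0
    _ = ω * lam := mul_comm _ _
end

section
/- Let d ≥ 1 and t ≥ 1 be integers, σ > 0, and κ, α, β ≥ 0. Let A be a d×d real symmetric matrix with λ_max(A) ≤ κ, B a real d×t matrix, and K a t×t real symmetric matrix all of whose entries satisfy K_{ij} ≤ α, such that the (d+t)×(d+t) block matrix [[A, B], [Bᵀ, K]] is positive semidefinite. Let S ⊆ {1, …, t} be nonempty with |S| = N, and suppose every column B_j of B with j ∈ S satisfies ‖B_j‖² ≥ β. Set Σ = A − B (K + σ²I_t)⁻¹ Bᵀ (a d×d real symmetric positive semidefinite matrix), and let X be a random vector in ℝ^d whose distribution is a multivariate Gaussian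 with mean m ∈ ℝ^d and covariance matrix Σ. Then for every δ ∈ (0, 1), with probability at least 1 − δ, ‖X − m‖² ≤ ω·κ − (ω·β/d)/(α + σ²/N), where ω = d + 2(√d + 1)·ln(1/δ). -/
open Matrix MeasureTheory ProbabilityTheory

namespace GEB

lemma gauss_cexp_aux (w : ℂ) (hw : w.re < 1/2) :
    ∫ z, Complex.exp (w * (z:ℂ)^2) ∂(gaussianReal 0 1) =
      ((√(2 * Real.pi))⁻¹ : ℝ) * ((Real.pi : ℂ) / (1/2 - w)) ^ (1/2 : ℂ) := by
  rw [integral_gaussianReal_eq_integral_smul (by norm_num)]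
  rw [← integral_gaussian_complex (b := 1/2 - w) (by simp; linarith)]
  rw [← integral_const_mul]
  congr 1
  ext z
  simp only [gaussianPDFReal_def, NNReal.coe_one, mul_one, sub_zero]
  rw [Complex.real_smul]
  push_cast
  rw [mul_assoc, ← Complex.exp_add]
  congr 2
  ring

lemma one_sub_two_I (u : ℝ) : (1 - 2 * (Complex.I * u) : ℂ) =
    Complex.exp (((1/2 * Real.log (1 + 4*u^2) : ℝ) : ℂ) + ((-Real.arctan (2*u) : ℝ):ℂ) * Complex.I) := by
  have h : 0 < 1 + 4*u^2 := by positivity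
  rw [Complex.exp_add, ← Complex.ofReal_exp, Complex.exp_mul_I, ← Complex.ofReal_cos,
    ← Complex.ofReal_sin, Real.cos_neg, Real.sin_neg, Real.cos_arctan, Real.sin_arctan]
  have e : Real.exp (1/2 * Real.log (1 + 4*u^2)) = √(1 + (2*u)^2) := by
    rw [mul_comm, Real.exp_mul, Real.exp_log h, ← Real.sqrt_eq_rpow]
    congr 1; ring
  rw [e]
  have h2 : √(1 + (2*u)^2) ≠ 0 := by positivity
  have h3 : ((√(1 + (2*u)^2) : ℝ) : ℂ) ≠ 0 := by exact_mod_cast h2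
  rw [Complex.ofReal_div, Complex.ofReal_neg, Complex.ofReal_div]
  generalize ((√(1 + (2*u)^2) : ℝ) : ℂ) = r at h3
  push_cast
  field_simp
  ring

lemma gauss_char (u : ℝ) :
    ∫ z, Complex.exp (((u * (z^2 - 1) : ℝ) : ℂ) * Complex.I) ∂(gaussianReal 0 1) =
      Complex.exp (((-(1/4) * Real.log (1 + 4*u^2) : ℝ) : ℂ) +
        ((1/2 * Real.arctan (2*u) - u : ℝ) : ℂ) * Complex.I) := by
  have h1 := gauss_cexp_aux (Complex.I * u) (by simp)
  have h2 : ∀ z : ℝ, Complex.exp (((u * (z^2 - 1) : ℝ) : ℂ) * Complex.I) =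
      Complex.exp (-u * Complex.I) * Complex.exp (Complex.I * u * (z:ℂ)^2) := by
    intro z
    rw [← Complex.exp_add]; congr 1; push_cast; ring
  simp_rw [h2]
  rw [integral_const_mul, h1]
  have h3 : ((Real.pi : ℂ) / (1/2 - Complex.I * u)) =
      Complex.exp (((Real.log (2*Real.pi) - 1/2 * Real.log (1 + 4*u^2) : ℝ) : ℂ) +
        ((Real.arctan (2*u) : ℝ):ℂ) * Complex.I) := by
    have : (1/2 - Complex.I * u : ℂ) = (1 - 2 * (Complex.I * u)) / 2 := by ring
    rw [this, one_sub_two_I]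
    have : (((Real.log (2*Real.pi) - 1/2 * Real.log (1 + 4*u^2) : ℝ) : ℂ) +
        ((Real.arctan (2*u) : ℝ):ℂ) * Complex.I) = ((Real.log (2*Real.pi) : ℝ) : ℂ) -
        (((1/2 * Real.log (1 + 4*u^2) : ℝ) : ℂ) + ((-Real.arctan (2*u) : ℝ):ℂ) * Complex.I) := by
      push_cast; ring
    rw [this, Complex.exp_sub, ← Complex.ofReal_exp, Real.exp_log (by positivity)]
    push_cast
    field_simp
  rw [h3, Complex.cpow_def_of_ne_zero (Complex.exp_ne_zero _), Complex.log_exp]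
  · have e : ((√(2 * Real.pi))⁻¹ : ℝ) = Real.exp (-(1/2 * Real.log (2 * Real.pi))) := by
      rw [Real.exp_neg, mul_comm (1/2) (Real.log _), Real.exp_mul, Real.exp_log (by positivity), ← Real.sqrt_eq_rpow]
    rw [e, Complex.ofReal_exp, ← Complex.exp_add, ← Complex.exp_add]
    congr 1
    push_cast
    ring
  · simp only [Complex.add_im, Complex.ofReal_im, Complex.mul_I_im, Complex.ofReal_re]
    have := Real.neg_pi_div_two_lt_arctan (2*u)
    linarith [Real.pi_pos]
  · simp only [Complex.add_im, Complex.ofReal_im, Complex.mul_I_im, Complex.ofReal_re]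
    have := Real.arctan_lt_pi_div_two (2*u)
    linarith [Real.pi_pos]

lemma gauss_mgf_integrable (l : ℝ) (hl : l < 1/2) :
    Integrable (fun z : ℝ => Real.exp (l * (z^2 - 1))) (gaussianReal 0 1) := by
  rw [gaussianReal_of_var_ne_zero _ (by norm_num)]
  rw [integrable_withDensity_iff_integrable_smul' (by fun_prop) (by simp [gaussianPDF])]
  have h : Integrable (fun z : ℝ => ((√(2 * Real.pi))⁻¹ * Real.exp (-l)) * Real.exp (-(1/2-l) * z^2)) :=
    (integrable_exp_neg_mul_sq (by linarith)).const_mul _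
  refine h.congr (Filter.Eventually.of_forall fun z => ?_)
  symm
  simp only
  rw [toReal_gaussianPDF, gaussianPDFReal_def]
  simp only [NNReal.coe_one, mul_one, sub_zero, smul_eq_mul]
  rw [mul_assoc, mul_assoc, ← Real.exp_add, ← Real.exp_add]
  congr 2
  ring

lemma gauss_mgf (l : ℝ) (hl : l < 1/2) :
    ∫ z, Real.exp (l * (z^2 - 1)) ∂(gaussianReal 0 1) =
      Real.exp (-l - 1/2 * Real.log (1 - 2*l)) := by
  rw [integral_gaussianReal_eq_integral_smul (by norm_num)]
  have h : ∀ z : ℝ, gaussianPDFReal 0 1 z • Real.exp (l * (z^2 - 1)) =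
      ((√(2 * Real.pi))⁻¹ * Real.exp (-l)) * Real.exp (-(1/2-l) * z^2) := by
    intro z
    rw [gaussianPDFReal_def]
    simp only [NNReal.coe_one, mul_one, sub_zero, smul_eq_mul]
    rw [mul_assoc, mul_assoc, ← Real.exp_add, ← Real.exp_add]
    congr 2
    ring
  simp_rw [h]
  rw [integral_const_mul, integral_gaussian]
  have h1 : 0 < 1 - 2*l := by linarith
  have e : ((√(2 * Real.pi))⁻¹ : ℝ) = Real.exp (-(1/2 * Real.log (2 * Real.pi))) := by
    rw [Real.exp_neg, mul_comm (1/2) (Real.log _), Real.exp_mul, Real.exp_log (by positivity), ← Real.sqrt_eq_rpow]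
  have e2 : √(Real.pi / (1/2 - l)) = Real.exp (1/2 * (Real.log (2 * Real.pi) - Real.log (1 - 2*l))) := by
    rw [mul_comm, Real.exp_mul, Real.exp_sub, Real.exp_log (by positivity), Real.exp_log h1, ← Real.sqrt_eq_rpow]
    congr 1
    have : 1/2 - l ≠ 0 := by linarith
    field_simp
  rw [e, e2, ← Real.exp_add, ← Real.exp_add]
  congr 1
  ring

lemma gauss_memLp_sq : MemLp (fun z : ℝ => z^2 - 1) 2 (gaussianReal 0 1) := by
  have h : MemLp (id : ℝ → ℝ) 4 (gaussianReal 0 1) := memLp_id_gaussianReal 4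
  have h2 : MemLp (fun z : ℝ => z^2) 2 (gaussianReal 0 1) := by
    have := h.norm_rpow_div (q := 2)
    have e : (4:ENNReal)/2 = 2 := by
      rw [show (4:ENNReal) = 2*2 by norm_num, ENNReal.mul_div_cancel_right] <;> norm_num
    rw [e] at this
    simpa using this
  exact h2.sub (memLp_const 1)

lemma gauss_m2 : ∫ z, z^2 ∂(gaussianReal 0 1) = 1 := by
  have := variance_id_gaussianReal (μ := 0) (v := 1)
  rw [variance_eq_integral (by fun_prop)] at this
  simpa using this

lemma gauss_m4 : ∫ z, z^4 ∂(gaussianReal 0 1) = 3 := by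
  rw [integral_gaussianReal_eq_integral_smul (by norm_num)]
  have h : ∀ z : ℝ, gaussianPDFReal 0 1 z • z^4 =
      (√(2 * Real.pi))⁻¹ * (fun y : ℝ => y^(4:ℝ) * Real.exp (-(1/2) * y^(2:ℝ))) |z| := by
    intro z
    rw [gaussianPDFReal_def]
    simp only [NNReal.coe_one, mul_one, sub_zero, smul_eq_mul]
    have h4 : |z|^(4:ℝ) = z^4 := by
      rw [show (4:ℝ) = ((4:ℕ):ℝ) by norm_num, Real.rpow_natCast]
      exact (show Even 4 by decide).pow_abs z
    have h2 : |z|^(2:ℝ) = z^2 := by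
      rw [show (2:ℝ) = ((2:ℕ):ℝ) by norm_num, Real.rpow_natCast]
      exact (show Even 2 by decide).pow_abs z
    rw [h4, h2, show -z^2/2 = -(1/2)*z^2 by ring]
    ring
  simp_rw [h]
  rw [integral_const_mul, integral_comp_abs (f := fun y : ℝ => y^(4:ℝ) * Real.exp (-(1/2) * y^(2:ℝ))),
    integral_rpow_mul_exp_neg_mul_rpow (by norm_num) (by norm_num) (by norm_num)]
  have g : Real.Gamma ((4+1)/2) = 3 / 4 * √Real.pi := by
    rw [show ((4:ℝ)+1)/2 = (1/2 + 1) + 1 by norm_num, Real.Gamma_add_one (by norm_num),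
      Real.Gamma_add_one (by norm_num), Real.Gamma_one_half_eq]; ring
  rw [g]
  have p : ((1/2 : ℝ))^(-((4:ℝ)+1)/2) = 4 * √2 := by
    rw [one_div, Real.inv_rpow (by norm_num), ← Real.rpow_neg (by norm_num),
      show -(-((4:ℝ)+1)/2) = 2 + 1/2 by norm_num, Real.rpow_add (by norm_num), ← Real.sqrt_eq_rpow]
    norm_num
  rw [p, Real.sqrt_mul (by norm_num)]
  have := Real.sqrt_pos.2 Real.pi_pos
  field_simp

lemma gauss_mean : ∫ z, (z^2 - 1) ∂(gaussianReal 0 1) = 0 := by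
  have h : Integrable (fun z : ℝ => z^2) (gaussianReal 0 1) := by
    have := (gauss_memLp_sq.integrable (by norm_num)).add (integrable_const (1:ℝ))
    refine this.congr (Filter.Eventually.of_forall fun z => ?_)
    simp
  rw [integral_sub h (integrable_const _), gauss_m2]
  simp

lemma gauss_var : Var[fun z : ℝ => z^2 - 1; gaussianReal 0 1] = 2 := by
  rw [variance_eq_sub gauss_memLp_sq, gauss_mean]
  have h4 : Integrable (fun z : ℝ => (z^2-1)^2) (gaussianReal 0 1) := gauss_memLp_sq.integrable_sq
  have h1 : Integrable (fun z : ℝ => (z^2-1)) (gaussianReal 0 1) := gauss_memLp_sq.integrable (by norm_num)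
  have e : ∫ z, z^4 ∂(gaussianReal 0 1) = ∫ z, ((z^2-1)^2 + (2 * (z^2-1) + 1)) ∂(gaussianReal 0 1) := by
    congr 1; ext z; ring
  have h5 : Integrable (fun z : ℝ => 2 * (z^2-1) + 1) (gaussianReal 0 1) :=
    (h1.const_mul 2).add (integrable_const _)
  rw [gauss_m4, integral_add h4 h5,
    integral_add (h1.const_mul 2) (integrable_const _), integral_const_mul, gauss_mean] at e
  simp at e
  simp
  linarith
end GEB

namespace GEB

/-- standard Gaussian product measure -/
noncomputable abbrev gpi (d : ℕ) : Measure (Fin d → ℝ) :=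
  Measure.pi (fun _ : Fin d => gaussianReal 0 1)

/-- weighted centred chi-square sum -/
noncomputable def YY {d : ℕ} (b : Fin d → ℝ) (z : Fin d → ℝ) : ℝ := ∑ i, b i * (z i ^ 2 - 1)

variable {d : ℕ} (b : Fin d → ℝ)

lemma YY_meas : Measurable (YY b) := by unfold YY; fun_prop

lemma memLp_coord (i : Fin d) : MemLp (fun z : Fin d → ℝ => b i * (z i ^ 2 - 1)) 2 (gpi d) := by
  have h := gauss_memLp_sq.comp_measurePreserving
    (measurePreserving_eval (fun _ : Fin d => gaussianReal 0 1) i)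
  exact h.const_mul (b i)

lemma YY_memLp : MemLp (YY b) 2 (gpi d) := by
  have : YY b = fun z => ∑ i, b i * (z i ^ 2 - 1) := rfl
  rw [this]
  exact memLp_finsetSum _ (fun i _ => memLp_coord b i)

lemma YY_mean : ∫ z, YY b z ∂(gpi d) = 0 := by
  unfold YY
  rw [integral_finsetSum _ (fun i _ => (memLp_coord b i).integrable (by norm_num))]
  refine Finset.sum_eq_zero fun i _ => ?_
  rw [integral_const_mul]
  have h := (measurePreserving_eval (fun _ : Fin d => gaussianReal 0 1) i)
  have h2 := gauss_mean
  rw [← h.map_eq, integral_map (measurable_pi_apply i).aemeasurable (by fun_prop)] at h2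
  have h3 : ∫ (a : Fin d → ℝ), (a i ^ 2 - 1) ∂(gpi d) = 0 := h2
  rw [h3, mul_zero]

lemma YY_var : ∫ z, YY b z ^ 2 ∂(gpi d) = 2 * ∑ i, b i ^ 2 := by
  have h1 : Var[YY b; gpi d] = ∫ z, YY b z ^ 2 ∂(gpi d) := by
    rw [variance_eq_sub (YY_memLp b), YY_mean]; simp
  rw [← h1]
  have h2 := variance_sum_pi (μ := fun _ : Fin d => gaussianReal 0 1)
    (X := fun i (x : ℝ) => b i * (x^2 - 1)) (fun i => gauss_memLp_sq.const_mul (b i))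
  have h3 : (∑ i, fun ω : Fin d → ℝ => b i * ((ω i)^2 - 1)) = YY b := by
    ext z; simp [YY]
  rw [h3] at h2
  rw [h2, Finset.mul_sum]
  refine Finset.sum_congr rfl fun i _ => ?_
  rw [variance_const_mul, gauss_var]; ring

lemma YY_sq_shift (q : ℝ) : ∫ z, (YY b z + q) ^ 2 ∂(gpi d) = 2 * ∑ i, b i ^ 2 + q^2 := by
  have h1 : Integrable (YY b) (gpi d) := (YY_memLp b).integrable (by norm_num)
  have h2 : Integrable (fun z => YY b z ^ 2) (gpi d) := (YY_memLp b).integrable_sq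
  have e : ∀ z, (YY b z + q)^2 = YY b z ^ 2 + (2 * q * YY b z + q^2) := by intro z; ring
  simp_rw [e]
  have h3 : Integrable (fun z => 2 * q * YY b z + q^2) (gpi d) :=
    (h1.const_mul _).add (integrable_const _)
  rw [integral_add h2 h3, integral_add (h1.const_mul _) (integrable_const _), integral_const_mul,
    YY_mean, YY_var]
  simp

lemma YY_sq_shift_int (q : ℝ) : Integrable (fun z => (YY b z + q) ^ 2) (gpi d) :=
  ((YY_memLp b).add (memLp_const q)).integrable_sq

lemma markov' (f : (Fin d → ℝ) → ℝ) (hf : ∀ z, 0 ≤ f z) (hi : Integrable f (gpi d)) (s F : ℝ)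
    (hF : ∀ z, s ≤ YY b z → F ≤ f z) : F * (gpi d).real {z | s ≤ YY b z} ≤ ∫ z, f z ∂(gpi d) := by
  rcases le_or_gt F 0 with h | h
  · exact (mul_nonpos_of_nonpos_of_nonneg h measureReal_nonneg).trans (integral_nonneg hf)
  · refine le_trans ?_ (mul_meas_ge_le_integral_of_nonneg (Filter.Eventually.of_forall hf) hi F)
    exact mul_le_mul_of_nonneg_left (measureReal_mono (fun z hz => hF z hz)) h.le

lemma cantelli (s : ℝ) (hs : 0 < s) :
    (2 * ∑ i, b i ^ 2 + s^2) * (gpi d).real {z | s ≤ YY b z} ≤ 2 * ∑ i, b i ^ 2 := by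
  set D := 2 * ∑ i, b i ^ 2 with hD
  have hD0 : 0 ≤ D := by positivity
  have h := markov' b (fun z => (YY b z + D/s)^2) (fun z => sq_nonneg _) (YY_sq_shift_int b _) s
    ((s + D/s)^2) (fun z hz => by
      have : 0 ≤ D/s := by positivity
      exact pow_le_pow_left₀ (by positivity) (by linarith) 2)
  rw [YY_sq_shift, ← hD] at h
  set p := (gpi d).real {z | s ≤ YY b z}
  have e1 : (s + D/s)^2 = (D + s^2)^2/s^2 := by field_simp; ring
  have e2 : D + (D/s)^2 = D * (D+s^2)/s^2 := by field_simp; ring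
  rw [e1, e2] at h
  have : (D + s^2) * ((D+s^2)*p) ≤ (D+s^2) * D := by
    have h' := mul_le_mul_of_nonneg_right h (sq_nonneg s)
    have hs2 : s^2 ≠ 0 := by positivity
    calc _ = (D + s^2)^2/s^2 * p * s^2 := by field_simp
      _ ≤ _ := h'
      _ = _ := by field_simp
  exact le_of_mul_le_mul_left this (by positivity)

lemma YY_char (τ : ℝ) : ∫ z, Complex.exp (((τ * YY b z : ℝ) : ℂ) * Complex.I) ∂(gpi d) =
    Complex.exp (((-(1/4) * ∑ i, Real.log (1 + 4*(τ * b i)^2) : ℝ) : ℂ) +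
        ((- ∑ i, (τ * b i - 1/2 * Real.arctan (2*(τ * b i))) : ℝ) : ℂ) * Complex.I) := by
  have h : ∀ z : Fin d → ℝ, Complex.exp (((τ * YY b z : ℝ) : ℂ) * Complex.I) =
      ∏ i, Complex.exp ((((τ * b i) * (z i ^2 - 1) : ℝ) : ℂ) * Complex.I) := by
    intro z
    rw [← Complex.exp_sum]
    congr 1
    rw [← Finset.sum_mul, ← Complex.ofReal_sum]
    congr 2
    unfold YY
    rw [Finset.mul_sum]
    refine Finset.sum_congr rfl fun i _ => by ring
  simp_rw [h]
  rw [integral_fintype_prod_eq_prod (fun i (x:ℝ) => Complex.exp ((((τ * b i) * (x ^2 - 1) : ℝ) : ℂ) * Complex.I))]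
  simp_rw [gauss_char]
  rw [← Complex.exp_sum]
  congr 1
  rw [Finset.sum_add_distrib, ← Finset.sum_mul, ← Complex.ofReal_sum, ← Complex.ofReal_sum]
  congr 3
  · rw [Finset.mul_sum]
  · rw [← Finset.sum_neg_distrib]; congr 1; ext i; ring

lemma YY_mgf (l : ℝ) (hl : ∀ i, l * b i < 1/2) :
    ∫ z, Real.exp (l * YY b z) ∂(gpi d) =
      Real.exp (∑ i, (-(l * b i) - 1/2 * Real.log (1 - 2*(l * b i)))) := by
  have h : ∀ z : Fin d → ℝ, Real.exp (l * YY b z) =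
      ∏ i, Real.exp ((l * b i) * (z i ^2 - 1)) := by
    intro z
    rw [← Real.exp_sum]
    congr 1
    unfold YY
    rw [Finset.mul_sum]
    refine Finset.sum_congr rfl fun i _ => by ring
  simp_rw [h]
  rw [integral_fintype_prod_eq_prod (fun i (x:ℝ) => Real.exp ((l * b i) * (x ^2 - 1)))]
  rw [Real.exp_sum]
  exact Finset.prod_congr rfl fun i _ => gauss_mgf _ (hl i)

lemma YY_mgf_int (l : ℝ) (hl : ∀ i, l * b i < 1/2) :
    Integrable (fun z => Real.exp (l * YY b z)) (gpi d) := by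
  have h : ∀ z : Fin d → ℝ, Real.exp (l * YY b z) =
      ∏ i, Real.exp ((l * b i) * (z i ^2 - 1)) := by
    intro z
    rw [← Real.exp_sum]
    congr 1
    unfold YY
    rw [Finset.mul_sum]
    refine Finset.sum_congr rfl fun i _ => by ring
  simp_rw [h]
  exact Integrable.fintype_prod (f := fun i (x:ℝ) => Real.exp ((l * b i) * (x ^2 - 1)))
    (fun i => gauss_mgf_integrable _ (hl i))

/-- elementary log inequality -/
lemma log_ineq (u : ℝ) (h0 : 0 ≤ u) (h1 : 2*u < 1) :
    -u - 1/2 * Real.log (1 - 2*u) ≤ u^2/(1-2*u) := by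
  have h2 : 0 < 1 - 2*u := by linarith
  have key : ∀ y : ℝ, 0 < y → y ≤ 1 → - Real.log y ≤ (1/y - y)/2 := by
    intro y hy hy1
    have h := Real.log_le_sub_one_of_pos hy
    have hx : 0 ≤ - Real.log y := by linarith [Real.log_nonpos hy.le hy1]
    have := Real.self_le_sinh_iff.2 hx
    rw [Real.sinh_eq, neg_neg, Real.exp_log hy, Real.exp_neg, Real.exp_log hy] at this
    rw [one_div]; linarith
  have := key (1-2*u) h2 (by linarith)
  have e : u^2/(1-2*u) = -u + 1/2 * ((1/(1-2*u) - (1-2*u))/2) := by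
    have h3 : 1 - 2*u ≠ 0 := h2.ne'
    rw [eq_comm, eq_div_iff h3]
    have : 1/(1-2*u) * (1-2*u) = 1 := by rw [one_div, inv_mul_cancel₀ h3]
    linear_combination (1/4) * this
  rw [e]; linarith

lemma laurent_massart (c D x : ℝ) (hx : 0 < x) (hc : 0 ≤ c) (hD : 0 < D) (hb0 : ∀ i, 0 ≤ b i)
    (hbc : ∀ i, b i ≤ c) (hbD : ∑ i, b i ^ 2 ≤ D) :
    (gpi d).real {z | 2*√(D*x) + 2*c*x ≤ YY b z} ≤ Real.exp (-x) := by
  set r := √x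
  set e := √D
  have hr : 0 < r := Real.sqrt_pos.2 hx
  have he : 0 < e := Real.sqrt_pos.2 hD
  have hr2 : r^2 = x := Real.sq_sqrt hx.le
  have he2 : e^2 = D := Real.sq_sqrt hD.le
  have hsq : √(D*x) = e * r := Real.sqrt_mul hD.le x
  set l := r / (e + 2*c*r) with hl
  have hden : 0 < e + 2*c*r := by positivity
  have hl0 : 0 < l := by positivity
  have hlc : 1 - 2*(l*c) = e / (e + 2*c*r) := by rw [hl]; field_simp; ring
  have hlc' : 0 < 1 - 2*(l*c) := by rw [hlc]; positivity
  have hlb : ∀ i, l * b i ≤ l * c := fun i => mul_le_mul_of_nonneg_left (hbc i) hl0.le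
  have hlb2 : ∀ i, l * b i < 1/2 := fun i => by linarith [hlb i]
  have h := markov' b (fun z => Real.exp (l * YY b z)) (fun z => (Real.exp_pos _).le)
    (YY_mgf_int b l hlb2) (2*√(D*x) + 2*c*x) (Real.exp (l * (2*√(D*x) + 2*c*x))) (fun z hz => by
      apply Real.exp_le_exp.2
      exact mul_le_mul_of_nonneg_left hz hl0.le)
  rw [YY_mgf b l hlb2] at h
  have hs : ∑ i, (-(l * b i) - 1/2 * Real.log (1 - 2*(l * b i))) ≤ l^2 * D / (1 - 2*(l*c)) := by
    calc _ ≤ ∑ i, (l^2/(1 - 2*(l*c))) * b i ^2 := by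
          refine Finset.sum_le_sum fun i _ => ?_
          refine (log_ineq _ (mul_nonneg hl0.le (hb0 i)) (by linarith [hlb2 i])).trans ?_
          rw [div_mul_eq_mul_div (l^2), mul_pow]
          exact div_le_div_of_nonneg_left (by positivity) hlc' (by linarith [hlb i])
      _ = (l^2/(1 - 2*(l*c))) * ∑ i, b i ^2 := by rw [Finset.mul_sum]
      _ ≤ (l^2/(1 - 2*(l*c))) * D := mul_le_mul_of_nonneg_left hbD (by positivity)
      _ = _ := by ring
  have h2 := h.trans (Real.exp_le_exp.2 hs)
  have e3 : l^2 * D / (1 - 2*(l*c)) = l * (2*√(D*x) + 2*c*x) + (-x) := by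
    rw [hlc, hsq, ← hr2, ← he2, hl]
    field_simp
    ring
  rw [e3, Real.exp_add] at h2
  exact le_of_mul_le_mul_left h2 (Real.exp_pos _)

end GEB

namespace GEB

lemma arctan_le_self' (u : ℝ) (hu : 0 ≤ u) : Real.arctan u ≤ u := by
  have h : MonotoneOn (fun u : ℝ => u - Real.arctan u) (Set.Ici 0) := by
    apply monotoneOn_of_deriv_nonneg (convex_Ici 0)
    · fun_prop
    · intro x _
      have := Real.differentiable_arctan
      exact DifferentiableAt.differentiableWithinAt (by fun_prop)
    · intro x _
      have : HasDerivAt (fun u : ℝ => u - Real.arctan u) (1 - 1/(1+x^2)) x :=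
        (hasDerivAt_id x).sub (Real.hasDerivAt_arctan x)
      rw [this.deriv]
      have : 1/(1+x^2) ≤ 1 := by rw [div_le_one (by positivity)]; nlinarith [sq_nonneg x]
      linarith
  have := h (Set.mem_Ici.2 le_rfl) (Set.mem_Ici.2 hu) hu
  simp at this; linarith

lemma phase_upper (u : ℝ) (hu : 0 ≤ u) : u - 1/2 * Real.arctan (2*u) ≤ u^2/2 := by
  have h : MonotoneOn (fun u : ℝ => u^2/2 - u + 1/2 * Real.arctan (2*u)) (Set.Ici 0) := by
    apply monotoneOn_of_deriv_nonneg (convex_Ici 0)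
    · fun_prop
    · intro x _
      have := Real.differentiable_arctan
      exact DifferentiableAt.differentiableWithinAt (by fun_prop)
    · intro x hx
      have hx : 0 < x := by simpa using hx
      have h1 : HasDerivAt (fun u : ℝ => Real.arctan (2*u)) (1/(1+(2*x)^2) * (2 * 1)) x :=
        ((hasDerivAt_id x).const_mul 2).arctan
      have h2 : HasDerivAt (fun u : ℝ => u^2/2 - u + 1/2 * Real.arctan (2*u))
          ((((2:ℕ):ℝ) * x^(2-1) * 1)/2 - 1 + 1/2 * (1/(1+(2*x)^2) * (2 * 1))) x :=
        ((((hasDerivAt_id x).pow 2).div_const 2).sub (hasDerivAt_id x)).add (h1.const_mul (1/2))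
      rw [h2.deriv]
      have e : ((((2:ℕ):ℝ) * x^(2-1) * 1)/2 - 1 + 1/2 * (1/(1+(2*x)^2) * (2 * 1))) =
        x * (1-2*x)^2/(1+(2*x)^2) := by
        field_simp; norm_num; ring
      rw [e]; positivity
  have := h (Set.mem_Ici.2 le_rfl) (Set.mem_Ici.2 hu) hu
  simp at this; linarith

variable {d : ℕ} (b : Fin d → ℝ)

lemma one_add_sum_le_prod' {ι : Type*} (s : Finset ι) (f : ι → ℝ) (hf : ∀ i, 0 ≤ f i) :
    1 + ∑ i ∈ s, f i ≤ ∏ i ∈ s, (1 + f i) := by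
  classical
  induction s using Finset.induction_on with
  | empty => simp
  | insert a s ha ih =>
    rw [Finset.sum_insert ha, Finset.prod_insert ha]
    have h1 : 0 ≤ ∑ i ∈ s, f i := Finset.sum_nonneg fun i _ => hf i
    nlinarith [hf a, mul_le_mul_of_nonneg_left ih (hf a), mul_nonneg (hf a) h1]

lemma phi_lower (v₀ v F : ℝ) (h0 : 0 ≤ v₀) (hπ : v₀ ≤ Real.pi) (hv : v₀ ≤ v) (hF : F ≤ 2.05)
    (hF0 : F ≤ 0.07 * v₀^2 + 1 - Real.cos v₀) : F ≤ 0.07 * v^2 + 1 - Real.cos v := by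
  rcases le_or_gt v Real.pi with h | h
  · have := Real.cos_le_cos_of_nonneg_of_le_pi h0 h hv
    nlinarith
  · have hp := Real.pi_gt_d4
    rcases le_or_gt v (2*Real.pi) with h2 | h2
    · have h3 := Real.cos_le_one_sub_mul_cos_sq (x := 2*Real.pi - v) (by rw [abs_of_nonneg] <;> linarith)
      rw [Real.cos_two_pi_sub] at h3
      have hB : 2/Real.pi^2 * Real.pi^2 = 2 := by field_simp
      set B := 2/Real.pi^2
      have hB0 : 0 < B := by positivity
      have hB1 : B ≤ 0.2032 := by
        by_contra hc
        push Not at hc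
        nlinarith
      have key : 0.07 * v^2 + B * (2*Real.pi - v)^2 ≥ 2.05 := by
        have : (0.07+B) * (0.07 * v^2 + B * (2*Real.pi - v)^2) =
          ((0.07+B)*v - 2*Real.pi*B)^2 + 0.07 * 4 * (B*Real.pi^2) := by ring
        rw [hB] at this
        nlinarith [sq_nonneg ((0.07+B)*v - 2*Real.pi*B)]
      linarith
    · have := Real.cos_le_one v
      nlinarith

lemma YY_cos (hb0 : ∀ i, 0 ≤ b i) (hb1 : ∑ i, b i ^ 2 = 1) (τ q : ℝ) (hτ : 0 < τ) (hq : τ ≤ 4*q)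
    (hπ : τ * q ≤ Real.pi) : ∃ ρ : ℝ, 0 ≤ ρ ∧ Real.exp (-τ^2) ≤ ρ ∧ ρ^4 * (1+4*τ^2) ≤ 1 ∧
    ρ * Real.cos (τ*q) ≤ ∫ z, Real.cos (τ * (YY b z + q)) ∂(gpi d) := by
  set χ := ∑ i, (τ * b i - 1/2 * Real.arctan (2*(τ * b i))) with hχ
  set L := ∑ i, Real.log (1 + 4*(τ * b i)^2) with hL
  have hu : ∀ i, 0 ≤ τ * b i := fun i => mul_nonneg hτ.le (hb0 i)
  have hsum : ∑ i, (τ * b i)^2 = τ^2 := by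
    simp_rw [mul_pow]; rw [← Finset.mul_sum, hb1, mul_one]
  have hχ0 : 0 ≤ χ := Finset.sum_nonneg fun i _ => by
    have := arctan_le_self' (2*(τ * b i)) (by linarith [hu i])
    linarith
  have hχ1 : χ ≤ τ^2/2 := by
    calc χ ≤ ∑ i, (τ * b i)^2/2 := Finset.sum_le_sum fun i _ => phase_upper _ (hu i)
      _ = _ := by rw [← Finset.sum_div, hsum]
  have hint : ∫ z, Real.cos (τ * (YY b z + q)) ∂(gpi d) =
      Real.exp (-(1/4) * L) * Real.cos (τ*q - χ) := by
    have h1 : ∀ z, Real.cos (τ * (YY b z + q)) =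
        (Complex.exp (((τ*q:ℝ):ℂ) * Complex.I) * Complex.exp (((τ * YY b z : ℝ) : ℂ) * Complex.I)).re := by
      intro z
      rw [← Complex.exp_add, ← add_mul, ← Complex.ofReal_add, Complex.exp_ofReal_mul_I_re]
      congr 1; ring
    have hI : Integrable (fun z => Complex.exp (((τ*q:ℝ):ℂ) * Complex.I) *
        Complex.exp (((τ * YY b z : ℝ) : ℂ) * Complex.I)) (gpi d) := by
      refine Integrable.const_mul ?_ _
      refine Integrable.of_bound (C := 1) ?_ (Filter.Eventually.of_forall fun z => ?_)
      · have := YY_meas b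
        exact (by fun_prop : Measurable _).aestronglyMeasurable
      · rw [Complex.norm_exp_ofReal_mul_I]
    simp_rw [h1]
    have h2 := integral_re hI
    simp only [RCLike.re_to_complex] at h2
    rw [h2, integral_const_mul, YY_char, ← Complex.exp_add]
    rw [show ((τ*q:ℝ):ℂ) * Complex.I + (((-(1/4) * L : ℝ) : ℂ) + ((-χ : ℝ) : ℂ) * Complex.I) =
      ((-(1/4) * L : ℝ) : ℂ) + ((τ*q - χ : ℝ) : ℂ) * Complex.I by push_cast; ring]
    rw [Complex.exp_add, ← Complex.ofReal_exp, Complex.re_ofReal_mul, Complex.exp_ofReal_mul_I_re]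
  have hpos : ∀ i, 0 < 1 + 4*(τ * b i)^2 := fun i => by positivity
  refine ⟨Real.exp (-(1/4) * L), (Real.exp_pos _).le, ?_, ?_, ?_⟩
  · apply Real.exp_le_exp.2
    have : L ≤ 4 * τ^2 := by
      calc L ≤ ∑ i, 4 * (τ * b i)^2 := Finset.sum_le_sum fun i _ => by
            have := Real.log_le_sub_one_of_pos (hpos i); linarith
        _ = _ := by rw [← Finset.mul_sum, hsum]
    linarith
  · have : 1 + 4*τ^2 ≤ Real.exp L := by
      rw [hL, Real.exp_sum]
      simp_rw [Real.exp_log (hpos _)]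
      have := one_add_sum_le_prod' Finset.univ (fun i => 4*(τ * b i)^2) (fun i => by positivity)
      rwa [← Finset.mul_sum, hsum] at this
    calc _ ≤ Real.exp (-(1/4) * L)^4 * Real.exp L := mul_le_mul_of_nonneg_left this (by positivity)
      _ = 1 := by
        rw [← Real.exp_nat_mul, ← Real.exp_add, Real.exp_eq_one_iff]; push_cast; ring
  · rw [hint]
    refine mul_le_mul_of_nonneg_left ?_ (Real.exp_pos _).le
    rw [← Real.cos_abs (τ*q - χ)]
    refine Real.cos_le_cos_of_nonneg_of_le_pi (abs_nonneg _) hπ ?_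
    rw [abs_le]
    constructor <;> nlinarith

/-- the cosine test bound -/
lemma cos_test (hb0 : ∀ i, 0 ≤ b i) (hb1 : ∑ i, b i ^ 2 = 1) (τ q s F c G : ℝ) (hτ : 0 < τ)
    (hq : τ ≤ 4*q) (hs : 0 ≤ s) (hπ : τ * (s + q) ≤ 3.1415) (hF : F ≤ 2.05)
    (hF0 : F ≤ 0.07 * (τ * (s+q))^2 + 1 - Real.cos (τ * (s+q)))
    (hc : c ≤ Real.cos (τ * q))
    (hG : (0 ≤ c ∧ G ≤ Real.exp (-τ^2) * c) ∨
      (c ≤ 0 ∧ ∃ R : ℝ, 0 ≤ R ∧ 1 ≤ R^4 * (1+4*τ^2) ∧ G ≤ R * c)) :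
    F * (gpi d).real {z | s ≤ YY b z} ≤ 0.07 * τ^2 * (2+q^2) + 1 - G := by
  have hp := Real.pi_gt_d4
  have hq0 : 0 < q := by linarith
  obtain ⟨ρ, h0, h1, h2, h3⟩ := YY_cos b hb0 hb1 τ q hτ hq (by nlinarith)
  have hG' : G ≤ ρ * c := by
    rcases hG with ⟨hc0, hG⟩ | ⟨hc0, R, hR, hR4, hG⟩
    · exact hG.trans (mul_le_mul_of_nonneg_right h1 hc0)
    · have : ρ ≤ R := by
        by_contra hcon
        push Not at hcon
        have : R^4 < ρ^4 := pow_lt_pow_left₀ hcon hR (by norm_num)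
        nlinarith [sq_nonneg τ]
      nlinarith
  have hcosI : Integrable (fun z => Real.cos (τ * (YY b z + q))) (gpi d) := by
    refine Integrable.of_bound (C := 1) ?_ (Filter.Eventually.of_forall fun z => ?_)
    · have := YY_meas b
      exact (by fun_prop : Measurable _).aestronglyMeasurable
    · exact Real.abs_cos_le_one _
  have hsqI := (YY_sq_shift_int b q).const_mul (0.07 * τ^2)
  have hI : Integrable (fun z => 0.07 * τ^2 * (YY b z + q)^2 + 1) (gpi d) := hsqI.add (integrable_const _)
  have h := markov' b (fun z => 0.07 * τ^2 * (YY b z + q)^2 + 1 - Real.cos (τ * (YY b z + q)))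
    (fun z => by
      have := Real.cos_le_one (τ * (YY b z + q))
      have : 0 ≤ 0.07 * τ^2 * (YY b z + q)^2 := by positivity
      linarith) (hI.sub hcosI) s F (fun z hz => by
      have := phi_lower (τ * (s+q)) (τ * (YY b z + q)) F (by positivity) (by linarith)
        (by nlinarith) hF hF0
      linarith [mul_pow τ (YY b z + q) 2])
  rw [integral_sub hI hcosI, integral_add hsqI (integrable_const _), integral_const_mul,
    YY_sq_shift, hb1] at h
  simp only [integral_const, probReal_univ, smul_eq_mul, mul_one] at h
  have : ρ * c ≤ ρ * Real.cos (τ*q) := mul_le_mul_of_nonneg_left hc h0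
  linarith

/-- alternating Taylor sums for cosine -/
noncomputable def CT (n : ℕ) (x : ℝ) : ℝ := ∑ k ∈ Finset.range n, (-1)^k * x^(2*k) / (2*k).factorial
/-- alternating Taylor sums for sine -/
noncomputable def ST (n : ℕ) (x : ℝ) : ℝ := ∑ k ∈ Finset.range n, (-1)^k * x^(2*k+1) / (2*k+1).factorial

lemma CT_deriv (n : ℕ) (x : ℝ) : HasDerivAt (CT (n+1)) (-ST n x) x := by
  have h : ∀ m, HasDerivAt (CT m) (∑ k ∈ Finset.range m, (-1)^k * (((2*k : ℕ):ℝ) * x^(2*k-1)) / (2*k).factorial) x := by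
    intro m
    unfold CT
    refine HasDerivAt.fun_sum fun k _ => ?_
    exact ((hasDerivAt_pow (2*k) x).const_mul _).div_const _
  convert h (n+1) using 1
  rw [Finset.sum_range_succ', ST, ← Finset.sum_neg_distrib]
  simp only [mul_zero, Nat.cast_zero, zero_mul, zero_div, add_zero]
  refine Finset.sum_congr rfl fun k _ => ?_
  have : (2*(k+1)).factorial = (2*k+2) * (2*k+1).factorial := by
    rw [show 2*(k+1) = (2*k+1)+1 by ring, Nat.factorial_succ]
  rw [this, show 2*(k+1)-1 = 2*k+1 by omega]
  have : ((2*k+1).factorial : ℝ) ≠ 0 := by positivity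
  push_cast
  field_simp
  ring

lemma ST_deriv (n : ℕ) (x : ℝ) : HasDerivAt (ST n) (CT n x) x := by
  have h : HasDerivAt (ST n) (∑ k ∈ Finset.range n, (-1)^k * (((2*k+1 : ℕ):ℝ) * x^(2*k+1-1)) / (2*k+1).factorial) x := by
    unfold ST
    refine HasDerivAt.fun_sum fun k _ => ?_
    exact ((hasDerivAt_pow (2*k+1) x).const_mul _).div_const _
  convert h using 1
  refine Finset.sum_congr rfl fun k _ => ?_
  rw [Nat.factorial_succ]
  have : ((2*k).factorial : ℝ) ≠ 0 := by positivity
  have h2 : ((2*k+1 : ℕ):ℝ) ≠ 0 := by positivity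
  rw [Nat.cast_mul, show 2*k+1-1 = 2*k by omega]
  field_simp

lemma taylor_cs (n : ℕ) : (∀ x : ℝ, 0 ≤ x → 0 ≤ (-1)^n * (Real.sin x - ST n x)) →
    (∀ x : ℝ, 0 ≤ x → 0 ≤ (-1)^(n+1) * (Real.cos x - CT (n+1) x)) := by
  intro hs x hx
  have h : MonotoneOn (fun x => (-1)^(n+1) * (Real.cos x - CT (n+1) x)) (Set.Ici 0) := by
    have hd : ∀ x, HasDerivAt (fun x => (-1)^(n+1) * (Real.cos x - CT (n+1) x))
        ((-1)^(n+1) * (-Real.sin x - -ST n x)) x := fun x =>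
      ((Real.hasDerivAt_cos x).sub (CT_deriv n x)).const_mul _
    apply monotoneOn_of_deriv_nonneg (convex_Ici 0)
    · exact fun x _ => (hd x).continuousAt.continuousWithinAt
    · exact fun x _ => (hd x).differentiableAt.differentiableWithinAt
    · intro y hy
      rw [(hd y).deriv]
      have := hs y (interior_subset hy)
      rw [pow_succ]; linarith
  have := h (Set.mem_Ici.2 le_rfl) (Set.mem_Ici.2 hx) hx
  have h0 : CT (n+1) 0 = 1 := by
    rw [CT, Finset.sum_range_succ']; simp
  simpa [h0] using this

lemma taylor_sn (n : ℕ) : (∀ x : ℝ, 0 ≤ x → 0 ≤ (-1)^(n) * (Real.cos x - CT n x)) →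
    (∀ x : ℝ, 0 ≤ x → 0 ≤ (-1)^n * (Real.sin x - ST n x)) := by
  intro hs x hx
  have h : MonotoneOn (fun x => (-1)^n * (Real.sin x - ST n x)) (Set.Ici 0) := by
    have hd : ∀ x, HasDerivAt (fun x => (-1)^n * (Real.sin x - ST n x))
        ((-1)^n * (Real.cos x - CT n x)) x := fun x =>
      ((Real.hasDerivAt_sin x).sub (ST_deriv n x)).const_mul _
    apply monotoneOn_of_deriv_nonneg (convex_Ici 0)
    · exact fun x _ => (hd x).continuousAt.continuousWithinAt
    · exact fun x _ => (hd x).differentiableAt.differentiableWithinAt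
    · intro y hy
      rw [(hd y).deriv]
      exact hs y (interior_subset hy)
  have := h (Set.mem_Ici.2 le_rfl) (Set.mem_Ici.2 hx) hx
  have h0 : ST n 0 = 0 := by
    rw [ST]; simp
  simpa [h0] using this

lemma cos_taylor (n : ℕ) : ∀ x : ℝ, 0 ≤ x → 0 ≤ (-1)^(n+1) * (Real.cos x - CT (n+1) x) := by
  induction n with
  | zero => intro x _; simp [CT]; exact Real.cos_le_one x
  | succ n ih => exact taylor_cs (n+1) (taylor_sn (n+1) ih)

lemma cos_le_CT (x : ℝ) (hx : 0 ≤ x) : Real.cos x ≤ CT 9 x := by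
  have := cos_taylor 8 x hx
  norm_num at this; linarith

lemma CT_le_cos (x : ℝ) (hx : 0 ≤ x) : CT 10 x ≤ Real.cos x := by
  have := cos_taylor 9 x hx
  norm_num at this; linarith

end GEB

namespace GEB

variable {d : ℕ} (b : Fin d → ℝ)

lemma exp_le_of (x e : ℝ) (h0 : 0 ≤ x) (h1 : x ≤ 1)
    (h : 1 + x + x^2/2 + x^3/6 + x^4/24 + x^5/120 + x^6/720 + x^7/5040 + x^8*9/(40320*8) ≤ e) :
    Real.exp x ≤ e := by
  have := Real.exp_bound' h0 h1 (n := 8) (by norm_num)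
  refine this.trans (le_trans (le_of_eq ?_) h)
  simp only [Finset.sum_range_succ, Nat.factorial, Finset.sum_range_zero]
  push_cast
  ring

lemma exp_neg_ge (x g : ℝ) (h0 : 0 ≤ x) (h1 : x/2 ≤ 1) (hg : 0 < g)
    (h : (1 + (x/2) + (x/2)^2/2 + (x/2)^3/6 + (x/2)^4/24 + (x/2)^5/120 + (x/2)^6/720 + (x/2)^7/5040
      + (x/2)^8*9/(40320*8))^2 * g ≤ 1) :
    g ≤ Real.exp (-x) := by
  have h2 := exp_le_of (x/2) _ (by positivity) h1 le_rfl
  have h3 : Real.exp x = Real.exp (x/2)^2 := by rw [← Real.exp_nat_mul]; congr 1; push_cast; ring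
  have h4 := pow_le_pow_left₀ (Real.exp_pos (x/2)).le h2 2
  rw [← h3] at h4
  rw [Real.exp_neg, le_inv_comm₀ hg (Real.exp_pos _)]
  refine h4.trans ?_
  rw [← one_div, le_div_iff₀ hg]
  exact h

lemma cos_le_num (x : ℝ) (hx : 0 ≤ x) : Real.cos x ≤ 1 - x^2/2 + x^4/24 - x^6/720 + x^8/40320
    - x^10/3628800 + x^12/479001600 - x^14/87178291200 + x^16/20922789888000 := by
  refine (cos_le_CT x hx).trans (le_of_eq ?_)
  simp [CT, Finset.sum_range_succ, Nat.factorial]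
  ring

lemma num_le_cos (x : ℝ) (hx : 0 ≤ x) : 1 - x^2/2 + x^4/24 - x^6/720 + x^8/40320
    - x^10/3628800 + x^12/479001600 - x^14/87178291200 + x^16/20922789888000 - x^18/6402373705728000
    ≤ Real.cos x := by
  refine le_trans (le_of_eq ?_) (CT_le_cos x hx)
  simp [CT, Finset.sum_range_succ, Nat.factorial]
  ring

lemma cert (hb0 : ∀ i, 0 ≤ b i) (hb1 : ∑ i, b i ^ 2 = 1) (x x' y : ℝ) (hy : x ≤ y) (hy' : y ≤ x')
    (τ q F c G e : ℝ) (hx0 : 0 ≤ x) (hτ : 0 < τ)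
    (hq : τ ≤ 4*q) (hπ : τ * (2*x + q) ≤ 3.1415) (hF : F ≤ 2.05) (hFp : 0 < F)
    (hF0 : Real.cos (τ * (2*x+q)) ≤ 0.07 * (τ * (2*x+q))^2 + 1 - F)
    (hc : c ≤ Real.cos (τ * q))
    (hG : (0 ≤ c ∧ G ≤ Real.exp (-τ^2) * c) ∨
      (c ≤ 0 ∧ ∃ R : ℝ, 0 ≤ R ∧ 1 ≤ R^4 * (1+4*τ^2) ∧ G ≤ R * c))
    (he : Real.exp x' ≤ e) (hE : e * (0.07 * τ^2 * (2+q^2) + 1 - G) ≤ F) :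
    (gpi d).real {z | 2*y ≤ YY b z} ≤ Real.exp (-y) := by
  have h := cos_test b hb0 hb1 τ q (2*x) F c G hτ hq (by linarith) hπ hF (by linarith) hc hG
  have h1 : (gpi d).real {z | 2*y ≤ YY b z} ≤ (gpi d).real {z | 2*x ≤ YY b z} :=
    measureReal_mono (fun z hz => by
      simp only [Set.mem_ofPred_eq] at hz ⊢; linarith)
  refine h1.trans ?_
  set p := (gpi d).real {z | 2*x ≤ YY b z}
  have hp0 : 0 ≤ p := measureReal_nonneg
  have hep : 0 < e := (Real.exp_pos _).trans_le he
  have h3 : e * (F * p) ≤ F := (mul_le_mul_of_nonneg_left h hep.le).trans hE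
  have h4 : e * p ≤ 1 := by
    by_contra hcon
    push Not at hcon
    nlinarith
  rw [Real.exp_neg, ← one_div, le_div_iff₀ (Real.exp_pos _)]
  have h5 : Real.exp y ≤ e := (Real.exp_le_exp.2 hy').trans he
  nlinarith [mul_le_mul_of_nonneg_left h5 hp0]

lemma cert0 (hb0 : ∀ i, 0 ≤ b i) (hb1 : ∑ i, b i ^ 2 = 1) (y : ℝ) (h1 : 0.0 ≤ y) (h2 : y ≤ 0.045) :
    (gpi d).real {z | 2*y ≤ YY b z} ≤ Real.exp (-y) := by
  refine cert b hb0 hb1 0.0 0.045 y h1 h2 0.8125 2.85 2.05 (-0.67785) (-0.49073) 1.04603 (by norm_num) (by norm_num)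
    (by norm_num) (by norm_num) (by norm_num) (by norm_num)
    ?_ ?_ (Or.inr ⟨by norm_num, 0.72395, by norm_num, by norm_num, by norm_num⟩) (exp_le_of _ _ (by norm_num) (by norm_num) (by norm_num)) (by norm_num)
  · have := cos_le_num (0.8125 * (2*0.0+2.85)) (by norm_num)
    norm_num at this ⊢
    linarith
  · have := num_le_cos (0.8125 * 2.85) (by norm_num)
    norm_num at this ⊢
    linarith

lemma cert1 (hb0 : ∀ i, 0 ≤ b i) (hb1 : ∑ i, b i ^ 2 = 1) (y : ℝ) (h1 : 0.045 ≤ y) (h2 : y ≤ 0.079) :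
    (gpi d).real {z | 2*y ≤ YY b z} ≤ Real.exp (-y) := by
  refine cert b hb0 hb1 0.045 0.079 y h1 h2 0.875 2.55 2.04722 (-0.61348) (-0.43213) 1.08221 (by norm_num) (by norm_num)
    (by norm_num) (by norm_num) (by norm_num) (by norm_num)
    ?_ ?_ (Or.inr ⟨by norm_num, 0.70438, by norm_num, by norm_num, by norm_num⟩) (exp_le_of _ _ (by norm_num) (by norm_num) (by norm_num)) (by norm_num)
  · have := cos_le_num (0.875 * (2*0.045+2.55)) (by norm_num)
    norm_num at this ⊢
    linarith
  · have := num_le_cos (0.875 * 2.55) (by norm_num)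
    norm_num at this ⊢
    linarith

lemma cert2 (hb0 : ∀ i, 0 ≤ b i) (hb1 : ∑ i, b i ^ 2 = 1) (y : ℝ) (h1 : 0.079 ≤ y) (h2 : y ≤ 0.11) :
    (gpi d).real {z | 2*y ≤ YY b z} ≤ Real.exp (-y) := by
  refine cert b hb0 hb1 0.079 0.11 y h1 h2 1.025 2.1 2.05 (-0.54945) (-0.36382) 1.11628 (by norm_num) (by norm_num)
    (by norm_num) (by norm_num) (by norm_num) (by norm_num)
    ?_ ?_ (Or.inr ⟨by norm_num, 0.66214, by norm_num, by norm_num, by norm_num⟩) (exp_le_of _ _ (by norm_num) (by norm_num) (by norm_num)) (by norm_num)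
  · have := cos_le_num (1.025 * (2*0.079+2.1)) (by norm_num)
    norm_num at this ⊢
    linarith
  · have := num_le_cos (1.025 * 2.1) (by norm_num)
    norm_num at this ⊢
    linarith

lemma cert3 (hb0 : ∀ i, 0 ≤ b i) (hb1 : ∑ i, b i ^ 2 = 1) (y : ℝ) (h1 : 0.11 ≤ y) (h2 : y ≤ 0.14) :
    (gpi d).real {z | 2*y ≤ YY b z} ≤ Real.exp (-y) := by
  refine cert b hb0 hb1 0.11 0.14 y h1 h2 1.0875 1.9 2.04244 (-0.47544) (-0.3073) 1.15028 (by norm_num) (by norm_num)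
    (by norm_num) (by norm_num) (by norm_num) (by norm_num)
    ?_ ?_ (Or.inr ⟨by norm_num, 0.64633, by norm_num, by norm_num, by norm_num⟩) (exp_le_of _ _ (by norm_num) (by norm_num) (by norm_num)) (by norm_num)
  · have := cos_le_num (1.0875 * (2*0.11+1.9)) (by norm_num)
    norm_num at this ⊢
    linarith
  · have := num_le_cos (1.0875 * 1.9) (by norm_num)
    norm_num at this ⊢
    linarith

lemma cert4 (hb0 : ∀ i, 0 ≤ b i) (hb1 : ∑ i, b i ^ 2 = 1) (y : ℝ) (h1 : 0.14 ≤ y) (h2 : y ≤ 0.1735) :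
    (gpi d).real {z | 2*y ≤ YY b z} ≤ Real.exp (-y) := by
  refine cert b hb0 hb1 0.14 0.1735 y h1 h2 1.2 1.65 2.05 (-0.39788) (-0.24676) 1.18947 (by norm_num) (by norm_num)
    (by norm_num) (by norm_num) (by norm_num) (by norm_num)
    ?_ ?_ (Or.inr ⟨by norm_num, 0.62018, by norm_num, by norm_num, by norm_num⟩) (exp_le_of _ _ (by norm_num) (by norm_num) (by norm_num)) (by norm_num)
  · have := cos_le_num (1.2 * (2*0.14+1.65)) (by norm_num)
    norm_num at this ⊢
    linarith
  · have := num_le_cos (1.2 * 1.65) (by norm_num)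
    norm_num at this ⊢
    linarith

lemma cert5 (hb0 : ∀ i, 0 ≤ b i) (hb1 : ∑ i, b i ^ 2 = 1) (y : ℝ) (h1 : 0.1735 ≤ y) (h2 : y ≤ 0.215) :
    (gpi d).real {z | 2*y ≤ YY b z} ≤ Real.exp (-y) := by
  refine cert b hb0 hb1 0.1735 0.215 y h1 h2 1.25 1.5 2.04589 (-0.29954) (-0.18255) 1.23987 (by norm_num) (by norm_num)
    (by norm_num) (by norm_num) (by norm_num) (by norm_num)
    ?_ ?_ (Or.inr ⟨by norm_num, 0.60942, by norm_num, by norm_num, by norm_num⟩) (exp_le_of _ _ (by norm_num) (by norm_num) (by norm_num)) (by norm_num)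
  · have := cos_le_num (1.25 * (2*0.1735+1.5)) (by norm_num)
    norm_num at this ⊢
    linarith
  · have := num_le_cos (1.25 * 1.5) (by norm_num)
    norm_num at this ⊢
    linarith

lemma cert6 (hb0 : ∀ i, 0 ≤ b i) (hb1 : ∑ i, b i ^ 2 = 1) (y : ℝ) (h1 : 0.215 ≤ y) (h2 : y ≤ 0.271) :
    (gpi d).real {z | 2*y ≤ YY b z} ≤ Real.exp (-y) := by
  refine cert b hb0 hb1 0.215 0.271 y h1 h2 1.35 1.25 2.00214 (-0.11644) (-0.06863) 1.31128 (by norm_num) (by norm_num)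
    (by norm_num) (by norm_num) (by norm_num) (by norm_num)
    ?_ ?_ (Or.inr ⟨by norm_num, 0.58934, by norm_num, by norm_num, by norm_num⟩) (exp_le_of _ _ (by norm_num) (by norm_num) (by norm_num)) (by norm_num)
  · have := cos_le_num (1.35 * (2*0.215+1.25)) (by norm_num)
    norm_num at this ⊢
    linarith
  · have := num_le_cos (1.35 * 1.25) (by norm_num)
    norm_num at this ⊢
    linarith

lemma cert7 (hb0 : ∀ i, 0 ≤ b i) (hb1 : ∑ i, b i ^ 2 = 1) (y : ℝ) (h1 : 0.271 ≤ y) (h2 : y ≤ 0.354) :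
    (gpi d).real {z | 2*y ≤ YY b z} ≤ Real.exp (-y) := by
  refine cert b hb0 hb1 0.271 0.354 y h1 h2 1.3625 1.15 2.04228 0.00392 0.00061 1.42476 (by norm_num) (by norm_num)
    (by norm_num) (by norm_num) (by norm_num) (by norm_num)
    ?_ ?_ (Or.inl ⟨by norm_num, by
      have h := exp_neg_ge 1.85640625 0.15623 (by norm_num) (by norm_num) (by norm_num) (by norm_num)
      rw [show -(1.3625:ℝ)^2 = -1.85640625 by norm_num]
      linarith⟩) (exp_le_of _ _ (by norm_num) (by norm_num) (by norm_num)) (by norm_num)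
  · have := cos_le_num (1.3625 * (2*0.271+1.15)) (by norm_num)
    norm_num at this ⊢
    linarith
  · have := num_le_cos (1.3625 * 1.15) (by norm_num)
    norm_num at this ⊢
    linarith

lemma cert8 (hb0 : ∀ i, 0 ≤ b i) (hb1 : ∑ i, b i ^ 2 = 1) (y : ℝ) (h1 : 0.354 ≤ y) (h2 : y ≤ 0.437) :
    (gpi d).real {z | 2*y ≤ YY b z} ≤ Real.exp (-y) := by
  refine cert b hb0 hb1 0.354 0.437 y h1 h2 1.125 1.35 2.05 0.05202 0.01467 1.54806 (by norm_num) (by norm_num)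
    (by norm_num) (by norm_num) (by norm_num) (by norm_num)
    ?_ ?_ (Or.inl ⟨by norm_num, by
      have h := exp_neg_ge 1.265625 0.28206 (by norm_num) (by norm_num) (by norm_num) (by norm_num)
      rw [show -(1.125:ℝ)^2 = -1.265625 by norm_num]
      linarith⟩) (exp_le_of _ _ (by norm_num) (by norm_num) (by norm_num)) (by norm_num)
  · have := cos_le_num (1.125 * (2*0.354+1.35)) (by norm_num)
    norm_num at this ⊢
    linarith
  · have := num_le_cos (1.125 * 1.35) (by norm_num)
    norm_num at this ⊢
    linarith

lemma cert9 (hb0 : ∀ i, 0 ≤ b i) (hb1 : ∑ i, b i ^ 2 = 1) (y : ℝ) (h1 : 0.437 ≤ y) (h2 : y ≤ 0.507) :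
    (gpi d).real {z | 2*y ≤ YY b z} ≤ Real.exp (-y) := by
  refine cert b hb0 hb1 0.437 0.507 y h1 h2 1.0875 1.25 2.04706 0.20984 0.0643 1.66031 (by norm_num) (by norm_num)
    (by norm_num) (by norm_num) (by norm_num) (by norm_num)
    ?_ ?_ (Or.inl ⟨by norm_num, by
      have h := exp_neg_ge 1.18265625 0.30646 (by norm_num) (by norm_num) (by norm_num) (by norm_num)
      rw [show -(1.0875:ℝ)^2 = -1.18265625 by norm_num]
      linarith⟩) (exp_le_of _ _ (by norm_num) (by norm_num) (by norm_num)) (by norm_num)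
  · have := cos_le_num (1.0875 * (2*0.437+1.25)) (by norm_num)
    norm_num at this ⊢
    linarith
  · have := num_le_cos (1.0875 * 1.25) (by norm_num)
    norm_num at this ⊢
    linarith

lemma cert10 (hb0 : ∀ i, 0 ≤ b i) (hb1 : ∑ i, b i ^ 2 = 1) (y : ℝ) (h1 : 0.507 ≤ y) (h2 : y ≤ 0.568) :
    (gpi d).real {z | 2*y ≤ YY b z} ≤ Real.exp (-y) := by
  refine cert b hb0 hb1 0.507 0.568 y h1 h2 1.0 1.3 2.05 0.26749 0.0984 1.76474 (by norm_num) (by norm_num)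
    (by norm_num) (by norm_num) (by norm_num) (by norm_num)
    ?_ ?_ (Or.inl ⟨by norm_num, by
      have h := exp_neg_ge 1.0 0.36787 (by norm_num) (by norm_num) (by norm_num) (by norm_num)
      rw [show -(1.0:ℝ)^2 = -1.0 by norm_num]
      linarith⟩) (exp_le_of _ _ (by norm_num) (by norm_num) (by norm_num)) (by norm_num)
  · have := cos_le_num (1.0 * (2*0.507+1.3)) (by norm_num)
    norm_num at this ⊢
    linarith
  · have := num_le_cos (1.0 * 1.3) (by norm_num)
    norm_num at this ⊢
    linarith

lemma cert11 (hb0 : ∀ i, 0 ≤ b i) (hb1 : ∑ i, b i ^ 2 = 1) (y : ℝ) (h1 : 0.568 ≤ y) (h2 : y ≤ 0.625) :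
    (gpi d).real {z | 2*y ≤ YY b z} ≤ Real.exp (-y) := by
  refine cert b hb0 hb1 0.568 0.625 y h1 h2 1.0125 1.15 2.05 0.39532 0.14181 1.86825 (by norm_num) (by norm_num)
    (by norm_num) (by norm_num) (by norm_num) (by norm_num)
    ?_ ?_ (Or.inl ⟨by norm_num, by
      have h := exp_neg_ge 1.02515625 0.35874 (by norm_num) (by norm_num) (by norm_num) (by norm_num)
      rw [show -(1.0125:ℝ)^2 = -1.02515625 by norm_num]
      linarith⟩) (exp_le_of _ _ (by norm_num) (by norm_num) (by norm_num)) (by norm_num)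
  · have := cos_le_num (1.0125 * (2*0.568+1.15)) (by norm_num)
    norm_num at this ⊢
    linarith
  · have := num_le_cos (1.0125 * 1.15) (by norm_num)
    norm_num at this ⊢
    linarith

lemma cert12 (hb0 : ∀ i, 0 ≤ b i) (hb1 : ∑ i, b i ^ 2 = 1) (y : ℝ) (h1 : 0.625 ≤ y) (h2 : y ≤ 0.677) :
    (gpi d).real {z | 2*y ≤ YY b z} ≤ Real.exp (-y) := by
  refine cert b hb0 hb1 0.625 0.677 y h1 h2 0.9625 1.15 2.04722 0.44745 0.17717 1.96797 (by norm_num) (by norm_num)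
    (by norm_num) (by norm_num) (by norm_num) (by norm_num)
    ?_ ?_ (Or.inl ⟨by norm_num, by
      have h := exp_neg_ge 0.92640625 0.39597 (by norm_num) (by norm_num) (by norm_num) (by norm_num)
      rw [show -(0.9625:ℝ)^2 = -0.92640625 by norm_num]
      linarith⟩) (exp_le_of _ _ (by norm_num) (by norm_num) (by norm_num)) (by norm_num)
  · have := cos_le_num (0.9625 * (2*0.625+1.15)) (by norm_num)
    norm_num at this ⊢
    linarith
  · have := num_le_cos (0.9625 * 1.15) (by norm_num)
    norm_num at this ⊢
    linarith

lemma cert13 (hb0 : ∀ i, 0 ≤ b i) (hb1 : ∑ i, b i ^ 2 = 1) (y : ℝ) (h1 : 0.677 ≤ y) (h2 : y ≤ 0.725) :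
    (gpi d).real {z | 2*y ≤ YY b z} ≤ Real.exp (-y) := by
  refine cert b hb0 hb1 0.677 0.725 y h1 h2 0.9625 1.05 2.05 0.53133 0.21039 2.06474 (by norm_num) (by norm_num)
    (by norm_num) (by norm_num) (by norm_num) (by norm_num)
    ?_ ?_ (Or.inl ⟨by norm_num, by
      have h := exp_neg_ge 0.92640625 0.39597 (by norm_num) (by norm_num) (by norm_num) (by norm_num)
      rw [show -(0.9625:ℝ)^2 = -0.92640625 by norm_num]
      linarith⟩) (exp_le_of _ _ (by norm_num) (by norm_num) (by norm_num)) (by norm_num)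
  · have := cos_le_num (0.9625 * (2*0.677+1.05)) (by norm_num)
    norm_num at this ⊢
    linarith
  · have := num_le_cos (0.9625 * 1.05) (by norm_num)
    norm_num at this ⊢
    linarith

lemma cert14 (hb0 : ∀ i, 0 ≤ b i) (hb1 : ∑ i, b i ^ 2 = 1) (y : ℝ) (h1 : 0.725 ≤ y) (h2 : y ≤ 0.75) :
    (gpi d).real {z | 2*y ≤ YY b z} ≤ Real.exp (-y) := by
  refine cert b hb0 hb1 0.725 0.75 y h1 h2 0.925 1.05 2.04988 0.56426 0.23981 2.11701 (by norm_num) (by norm_num)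
    (by norm_num) (by norm_num) (by norm_num) (by norm_num)
    ?_ ?_ (Or.inl ⟨by norm_num, by
      have h := exp_neg_ge 0.855625 0.42501 (by norm_num) (by norm_num) (by norm_num) (by norm_num)
      rw [show -(0.925:ℝ)^2 = -0.855625 by norm_num]
      linarith⟩) (exp_le_of _ _ (by norm_num) (by norm_num) (by norm_num)) (by norm_num)
  · have := cos_le_num (0.925 * (2*0.725+1.05)) (by norm_num)
    norm_num at this ⊢
    linarith
  · have := num_le_cos (0.925 * 1.05) (by norm_num)
    norm_num at this ⊢
    linarith

lemma small_x (hb0 : ∀ i, 0 ≤ b i) (hb1 : ∑ i, b i ^ 2 = 1) (y : ℝ) (h0 : 0 ≤ y) (h2 : y ≤ 0.75) :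
    (gpi d).real {z | 2*y ≤ YY b z} ≤ Real.exp (-y) := by
  rcases le_or_gt y 0.045 with h | h0'
  · exact cert0 b hb0 hb1 y (by linarith) h
  rcases le_or_gt y 0.079 with h | h1'
  · exact cert1 b hb0 hb1 y h0'.le h
  rcases le_or_gt y 0.11 with h | h2'
  · exact cert2 b hb0 hb1 y h1'.le h
  rcases le_or_gt y 0.14 with h | h3'
  · exact cert3 b hb0 hb1 y h2'.le h
  rcases le_or_gt y 0.1735 with h | h4'
  · exact cert4 b hb0 hb1 y h3'.le h
  rcases le_or_gt y 0.215 with h | h5'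
  · exact cert5 b hb0 hb1 y h4'.le h
  rcases le_or_gt y 0.271 with h | h6'
  · exact cert6 b hb0 hb1 y h5'.le h
  rcases le_or_gt y 0.354 with h | h7'
  · exact cert7 b hb0 hb1 y h6'.le h
  rcases le_or_gt y 0.437 with h | h8'
  · exact cert8 b hb0 hb1 y h7'.le h
  rcases le_or_gt y 0.507 with h | h9'
  · exact cert9 b hb0 hb1 y h8'.le h
  rcases le_or_gt y 0.568 with h | h10'
  · exact cert10 b hb0 hb1 y h9'.le h
  rcases le_or_gt y 0.625 with h | h11'
  · exact cert11 b hb0 hb1 y h10'.le h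
  rcases le_or_gt y 0.677 with h | h12'
  · exact cert12 b hb0 hb1 y h11'.le h
  rcases le_or_gt y 0.725 with h | h13'
  · exact cert13 b hb0 hb1 y h12'.le h
  rcases le_or_gt y 0.75 with h | h14'
  · exact cert14 b hb0 hb1 y h13'.le h
  · linarith

end GEB

namespace GEB

variable {d : ℕ} (b : Fin d → ℝ)

lemma h_deriv (x : ℝ) : HasDerivAt (fun x : ℝ => (1 + 2*x^2) * Real.exp (-x))
    ((4*x - 1 - 2*x^2) * Real.exp (-x)) x := by
  have h1 : HasDerivAt (fun x : ℝ => 1 + 2*x^2) (4*x) x := by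
    have := ((hasDerivAt_pow 2 x).const_mul 2).const_add 1
    refine this.congr_deriv ?_
    norm_num; ring
  have h2 : HasDerivAt (fun x : ℝ => Real.exp (-x)) (Real.exp (-x) * (-1)) x :=
    (hasDerivAt_neg x).exp
  refine (h1.mul h2).congr_deriv ?_
  ring

lemma mid_exp (x : ℝ) (h1 : 0.75 ≤ x) (h2 : x ≤ 2.8) : Real.exp x ≤ 1 + 2*x^2 := by
  rcases le_or_gt x 1.7 with h | h
  · have hm : MonotoneOn (fun x : ℝ => (1 + 2*x^2) * Real.exp (-x)) (Set.Icc 0.75 1.7) := by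
      apply monotoneOn_of_deriv_nonneg (convex_Icc _ _)
      · exact fun x _ => (h_deriv x).continuousAt.continuousWithinAt
      · exact fun x _ => (h_deriv x).differentiableAt.differentiableWithinAt
      · intro y hy
        rw [(h_deriv y).deriv]
        have hy := interior_subset hy
        have := hy.1
        have := hy.2
        exact mul_nonneg (by nlinarith) (Real.exp_pos _).le
    have := hm (Set.left_mem_Icc.2 (by norm_num)) ⟨h1, h⟩ h1
    simp only at this
    have e := exp_le_of 0.75 2.12 (by norm_num) (by norm_num) (by norm_num)
    have e1 : 1 ≤ (1 + 2*0.75^2) * Real.exp (-0.75) := by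
      rw [Real.exp_neg, ← div_eq_mul_inv, le_div_iff₀ (Real.exp_pos _)]; norm_num at e ⊢; linarith
    have := e1.trans this
    rw [Real.exp_neg, ← div_eq_mul_inv, le_div_iff₀ (Real.exp_pos _)] at this
    linarith
  · rcases le_or_gt x 1.8 with h' | h'
    · have e := exp_le_of 0.9 2.46 (by norm_num) (by norm_num) (by norm_num)
      have e2 : Real.exp 1.8 = Real.exp 0.9 ^ 2 := by
        rw [← Real.exp_nat_mul]; norm_num
      have := Real.exp_le_exp.2 h'
      have := pow_le_pow_left₀ (Real.exp_pos _).le e 2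
      nlinarith
    · have hm : AntitoneOn (fun x : ℝ => (1 + 2*x^2) * Real.exp (-x)) (Set.Icc 1.8 2.8) := by
        apply antitoneOn_of_deriv_nonpos (convex_Icc _ _)
        · exact fun x _ => (h_deriv x).continuousAt.continuousWithinAt
        · exact fun x _ => (h_deriv x).differentiableAt.differentiableWithinAt
        · intro y hy
          rw [(h_deriv y).deriv]
          have hy := interior_subset hy
          have := hy.1
          have := hy.2
          exact mul_nonpos_of_nonpos_of_nonneg (by nlinarith) (Real.exp_pos _).le
      have := hm ⟨h'.le, h2⟩ (Set.right_mem_Icc.2 (by norm_num)) h2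
      simp only at this
      have e := exp_le_of 0.7 2.014 (by norm_num) (by norm_num) (by norm_num)
      have e2 : Real.exp 2.8 = Real.exp 0.7 ^ 4 := by
        rw [← Real.exp_nat_mul]; norm_num
      have e3 := pow_le_pow_left₀ (Real.exp_pos _).le e 4
      rw [← e2] at e3
      have e1 : 1 ≤ (1 + 2*2.8^2) * Real.exp (-2.8) := by
        rw [Real.exp_neg, ← div_eq_mul_inv, le_div_iff₀ (Real.exp_pos _)]; norm_num at e3 ⊢; linarith
      have := e1.trans this
      rw [Real.exp_neg, ← div_eq_mul_inv, le_div_iff₀ (Real.exp_pos _)] at this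
      linarith

lemma small_mid_x (hb0 : ∀ i, 0 ≤ b i) (hb1 : ∑ i, b i ^ 2 = 1) (x : ℝ) (h0 : 0 ≤ x) (h2 : x ≤ 2.8) :
    (gpi d).real {z | 2*x ≤ YY b z} ≤ Real.exp (-x) := by
  rcases le_or_gt x 0.75 with h | h
  · exact small_x b hb0 hb1 x h0 h
  · have hc := cantelli b (2*x) (by linarith)
    rw [hb1] at hc
    have he := mid_exp x h.le h2
    have hp : 0 ≤ (gpi d).real {z | 2*x ≤ YY b z} := measureReal_nonneg
    rw [Real.exp_neg, ← one_div, le_div_iff₀ (Real.exp_pos _)]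
    nlinarith [mul_le_mul_of_nonneg_left he hp]

lemma norm_x (a : Fin d → ℝ) (ha0 : ∀ i, 0 ≤ a i) (r : ℝ) (hr : 0 < r) (hr2 : r^2 = ∑ i, a i ^2)
    (x s : ℝ) (h0 : 0 ≤ x) (h2 : x ≤ 2.8) (hs : 2*r*x ≤ s) :
    (gpi d).real {z | s ≤ YY a z} ≤ Real.exp (-x) := by
  refine le_trans (measureReal_mono ?_) (small_mid_x (fun i => a i / r) (fun i => by
    have := ha0 i; positivity) (by
      simp_rw [div_pow]; rw [← Finset.sum_div, ← hr2, div_self (by positivity)]) x h0 h2)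
  intro z hz
  have e : YY (fun i => a i / r) z = YY a z / r := by
    unfold YY; rw [Finset.sum_div]; refine Finset.sum_congr rfl fun i _ => by ring
  have hz : s ≤ YY a z := hz
  change 2*x ≤ YY (fun i => a i / r) z
  rw [e, le_div_iff₀ hr]; linarith

lemma gauss_shift (m : ℝ) (s : Set ℝ) (hs : MeasurableSet s) (h : ∀ x ∈ s, m * x ≤ 0) :
    gaussianReal m 1 s ≤ ENNReal.ofReal (Real.exp (-m^2/2)) * gaussianReal 0 1 s := by
  rw [gaussianReal_apply _ (by norm_num), gaussianReal_apply _ (by norm_num),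
    ← lintegral_const_mul _ (by fun_prop)]
  refine setLIntegral_mono (by fun_prop) fun x hx => ?_
  rw [gaussianPDF, gaussianPDF, ← ENNReal.ofReal_mul (Real.exp_pos _).le]
  apply ENNReal.ofReal_le_ofReal
  rw [gaussianPDFReal_def, gaussianPDFReal_def]
  simp only [NNReal.coe_one, mul_one, sub_zero]
  rw [mul_left_comm, ← Real.exp_add]
  refine mul_le_mul_of_nonneg_left (Real.exp_le_exp.2 ?_) (by positivity)
  have := h x hx
  nlinarith

lemma gauss_tail (r : ℝ) (hr : 0 ≤ r) :
    (gaussianReal 0 1).real {z | r < |z|} ≤ Real.exp (-r^2/2) := by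
  have h1 : gaussianReal 0 1 (Set.Ioi r) ≤ ENNReal.ofReal (Real.exp (-r^2/2)) * gaussianReal 0 1 (Set.Ioi 0) := by
    have := gauss_shift (-r) (Set.Ioi 0) measurableSet_Ioi (fun x hx => by
      have : 0 < x := hx
      nlinarith)
    rw [neg_sq] at this
    refine le_trans (le_of_eq ?_) this
    have e := gaussianReal_map_add_const (μ := 0) (v := 1) (-r)
    rw [zero_add] at e
    rw [← e, Measure.map_apply (by fun_prop) measurableSet_Ioi]
    congr 1
    ext x; simp
  have h2 : gaussianReal 0 1 (Set.Iio (-r)) ≤ ENNReal.ofReal (Real.exp (-r^2/2)) * gaussianReal 0 1 (Set.Iio 0) := by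
    have := gauss_shift r (Set.Iio 0) measurableSet_Iio (fun x hx => by
      have : x < 0 := hx
      nlinarith)
    refine le_trans (le_of_eq ?_) this
    have e := gaussianReal_map_add_const (μ := 0) (v := 1) r
    rw [zero_add] at e
    rw [← e, Measure.map_apply (by fun_prop) measurableSet_Iio]
    congr 1
    ext x; simp [lt_neg_iff_add_neg]
  have h3 : {z : ℝ | r < |z|} = Set.Ioi r ∪ Set.Iio (-r) := by
    ext z; simp [lt_abs, lt_neg]
  have h4 : gaussianReal 0 1 (Set.Ioi 0) + gaussianReal 0 1 (Set.Iio 0) ≤ 1 := by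
    rw [← measure_union (by
      rw [Set.disjoint_left]; intro x hx hx'
      have h1 : 0 < x := hx
      have h2 : x < 0 := hx'
      linarith) measurableSet_Iio]
    exact prob_le_one
  refine ENNReal.toReal_le_of_le_ofReal (Real.exp_pos _).le ?_
  rw [h3]
  calc _ ≤ _ := measure_union_le _ _
    _ ≤ _ := add_le_add h1 h2
    _ = ENNReal.ofReal (Real.exp (-r^2/2)) * (gaussianReal 0 1 (Set.Ioi 0) + gaussianReal 0 1 (Set.Iio 0)) := by
      rw [mul_add]
    _ ≤ ENNReal.ofReal (Real.exp (-r^2/2)) * 1 := by gcongr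
    _ = _ := mul_one _

lemma max_tail (a : Fin d → ℝ) (ha0 : ∀ i, 0 ≤ a i) (hs : ∑ i, a i ≤ d) (u : ℝ) (hu : 0 ≤ u) :
    (gpi d).real {z | d * u < ∑ i, a i * z i ^2} ≤ d * Real.exp (-u/2) := by
  have hsub : {z : Fin d → ℝ | d * u < ∑ i, a i * z i ^2} ⊆ ⋃ i, {z | √u < |z i|} := by
    intro z hz
    by_contra hcon
    simp only [Set.mem_iUnion, not_exists] at hcon
    have hle : ∀ i, z i ^ 2 ≤ u := fun i => by
      have h : |z i| ≤ √u := not_lt.1 (hcon i)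
      have := pow_le_pow_left₀ (abs_nonneg _) h 2
      rwa [sq_abs, Real.sq_sqrt hu] at this
    have hz : d * u < ∑ i, a i * z i ^2 := hz
    have : ∑ i, a i * z i ^2 ≤ ∑ i, a i * u := Finset.sum_le_sum fun i _ =>
      mul_le_mul_of_nonneg_left (hle i) (ha0 i)
    rw [← Finset.sum_mul] at this
    have := mul_le_mul_of_nonneg_right hs hu
    linarith
  refine (measureReal_mono hsub).trans ((measureReal_iUnion_fintype_le _).trans ?_)
  calc _ ≤ ∑ i : Fin d, Real.exp (-u/2) := by
        refine Finset.sum_le_sum fun i _ => ?_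
        have h := (measurePreserving_eval (fun _ : Fin d => gaussianReal 0 1) i).measureReal_preimage
          (s := {z : ℝ | √u < |z|}) (measurableSet_lt (by fun_prop) (by fun_prop)).nullMeasurableSet
        have h2 := gauss_tail (√u) (Real.sqrt_nonneg _)
        rw [Real.sq_sqrt hu, ← h] at h2
        exact h2
    _ = _ := by simp

lemma sumsq_le (a : Fin d → ℝ) (ha0 : ∀ i, 0 ≤ a i) (c : ℝ) (hc : 0 ≤ c) (hs : ∑ i, a i ≤ d) (h : ∀ i, a i ≤ c) :
    ∑ i, a i^2 ≤ c * d := by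
  calc _ ≤ ∑ i, c * a i := Finset.sum_le_sum fun i _ => by
        rw [sq]; exact mul_le_mul_of_nonneg_right (h i) (ha0 i)
    _ = c * ∑ i, a i := by rw [Finset.mul_sum]
    _ ≤ _ := mul_le_mul_of_nonneg_left hs hc

lemma core (hd : 1 ≤ d) (a : Fin d → ℝ) (ha0 : ∀ i, 0 ≤ a i) (hs : ∑ i, a i ≤ d)
    (hmax : ∀ i, ((d:ℝ) - 1) * a i ≤ d) (x : ℝ) (hx : 0 < x) :
    (gpi d).real {z | d + 2*(√d+1)*x < ∑ i, a i * z i ^2} ≤ Real.exp (-x) := by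
  have hsub : {z : Fin d → ℝ | d + 2*(√d+1)*x < ∑ i, a i * z i ^2} ⊆ {z | 2*(√d+1)*x ≤ YY a z} := by
    intro z hz
    have hz : d + 2*(√d+1)*x < ∑ i, a i * z i ^2 := hz
    change 2*(√d+1)*x ≤ YY a z
    have : YY a z = ∑ i, a i * z i ^2 - ∑ i, a i := by
      unfold YY; rw [← Finset.sum_sub_distrib]; refine Finset.sum_congr rfl fun i _ => by ring
    linarith
  have hdR : (1:ℝ) ≤ d := by exact_mod_cast hd
  have hsd : 1 ≤ √(d:ℝ) := Real.one_le_sqrt.2 hdR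
  have hsd2 : √(d:ℝ)^2 = d := Real.sq_sqrt (by linarith)
  have hale : ∀ i, a i ≤ d := fun i =>
    (Finset.single_le_sum (f := a) (fun i _ => ha0 i) (Finset.mem_univ i)).trans hs
  rcases le_or_gt x 2.8 with hx2 | hx2
  · by_cases h0 : ∑ i, a i^2 = 0
    · have ha : ∀ i, a i = 0 := fun i => by
        have := (Finset.sum_eq_zero_iff_of_nonneg (fun i _ => sq_nonneg (a i))).1 h0 i (Finset.mem_univ i)
        exact pow_eq_zero_iff (two_ne_zero) |>.1 this
      have : {z : Fin d → ℝ | d + 2*(√d+1)*x < ∑ i, a i * z i ^2} = ∅ := by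
        ext z
        simp only [ha, zero_mul, Finset.sum_const_zero]
        constructor
        · intro h
          have h : d + 2*(√d+1)*x < 0 := h
          have : 0 < 2*(√d+1)*x := by positivity
          linarith
        · intro h; exact h.elim
      rw [this, measureReal_empty]; exact (Real.exp_pos _).le
    · have hpos : 0 < ∑ i, a i^2 := lt_of_le_of_ne (by positivity) (Ne.symm h0)
      have hn : ∑ i, a i^2 ≤ (√d+1)^2 := by
        rcases Nat.lt_or_ge 1 d with h | h
        · have hd2 : (2:ℝ) ≤ d := by exact_mod_cast h
          have := sumsq_le a ha0 (d/(d-1)) (by apply div_nonneg <;> linarith) hs (fun i => by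
            rw [le_div_iff₀ (by linarith)]; linarith [hmax i])
          refine this.trans ?_
          rw [div_mul_eq_mul_div, div_le_iff₀ (by linarith)]
          nlinarith
        · have hd1 : (d:ℝ) = 1 := by
            have : d = 1 := by omega
            simp [this]
          have := sumsq_le a ha0 d (by linarith) hs hale
          nlinarith
      have hr : √(∑ i, a i^2) ≤ √d+1 := by
        rw [Real.sqrt_le_left (by positivity)]; exact hn
      refine (measureReal_mono hsub).trans (norm_x a ha0 (√(∑ i, a i^2)) (Real.sqrt_pos.2 hpos)
        (Real.sq_sqrt hpos.le) x _ hx.le hx2 ?_)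
      nlinarith
  · rcases Nat.lt_or_ge d 3 with h3 | h3
    · have hcase : (d:ℝ) = 1 ∨ (d:ℝ) = 2 := by
        have : d = 1 ∨ d = 2 := by omega
        rcases this with h | h <;> simp [h]
      have hu : 0 ≤ 1 + 2*(√d+1)*x/d := by positivity
      have h := max_tail a ha0 hs (1 + 2*(√d+1)*x/d) hu
      have e : d * (1 + 2*(√d+1)*x/d) = d + 2*(√d+1)*x := by field_simp
      rw [e] at h
      refine h.trans ?_
      have e1 := Real.add_one_le_exp (1/2)
      rcases hcase with hc | hc
      · rw [hc]; simp only [Real.sqrt_one, one_mul]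
        apply Real.exp_le_exp.2; linarith
      · rw [hc]
        have h2 : 1.414 ≤ √(2:ℝ) := Real.le_sqrt_of_sq_le (by norm_num)
        have e3 : (2:ℝ) ≤ Real.exp 0.72 := by
          have := Real.quadratic_le_exp_of_nonneg (x := 0.36) (by norm_num)
          have e4 : Real.exp 0.72 = Real.exp 0.36 ^2 := by rw [← Real.exp_nat_mul]; norm_num
          rw [e4]
          nlinarith
        calc 2 * Real.exp (-(1 + 2*(√2+1)*x/2)/2) ≤ Real.exp 0.72 * Real.exp (-(1 + 2*(√2+1)*x/2)/2) :=
              mul_le_mul_of_nonneg_right e3 (Real.exp_pos _).le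
          _ = Real.exp (0.72 + (-(1 + 2*(√2+1)*x/2)/2)) := by rw [Real.exp_add]
          _ ≤ _ := by apply Real.exp_le_exp.2; nlinarith
    · rcases Nat.lt_or_ge d 4 with h4 | h4
      · have hd3 : (d:ℝ) = 3 := by
          have : d = 3 := by omega
          simp [this]
        have h3' : 1.732 ≤ √(d:ℝ) := Real.le_sqrt_of_sq_le (by rw [hd3]; norm_num)
        have ha : ∀ i, a i ≤ 3/2 := fun i => by have := hmax i; rw [hd3] at this; linarith
        have hn := sumsq_le a ha0 (3/2) (by norm_num) hs ha
        rw [hd3] at hn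
        refine (measureReal_mono hsub).trans ?_
        rcases le_or_gt x 3 with hx3 | hx3
        · have hc := cantelli a (2*(√d+1)*x) (by positivity)
          set p := (gpi d).real {z | 2*(√d+1)*x ≤ YY a z}
          have hp : 0 ≤ p := measureReal_nonneg
          have hp1 : p ≤ 1 := measureReal_le_one
          have hss : (15.29:ℝ)^2 ≤ (2*(√d+1)*x)^2 := by
            apply pow_le_pow_left₀ (by norm_num); nlinarith
          have h5 : 26 * p ≤ 1 := by nlinarith [mul_le_mul_of_nonneg_right hss hp]
          have e := exp_le_of 1 2.72 (by norm_num) (by norm_num) (by norm_num)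
          have e2 : Real.exp 3 = Real.exp 1 ^ 3 := by rw [← Real.exp_nat_mul]; norm_num
          have e3 := pow_le_pow_left₀ (Real.exp_pos _).le e 3
          have e4 := Real.exp_le_exp.2 hx3
          have e5 : Real.exp x ≤ 26 := by rw [e2] at e4; norm_num at e3; linarith
          rw [Real.exp_neg, ← one_div, le_div_iff₀ (Real.exp_pos _)]
          nlinarith [mul_le_mul_of_nonneg_left e5 hp]
        · have h := laurent_massart a (3/2) 4.5 x hx (by norm_num) (by norm_num) ha0 ha (by linarith)
          refine le_trans (measureReal_mono fun z hz => ?_) h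
          have hz : 2*(√d+1)*x ≤ YY a z := hz
          refine le_trans ?_ hz
          have : √(4.5*x) ≤ 1.2248*x := Real.sqrt_le_iff.2 ⟨by positivity, by nlinarith⟩
          nlinarith
      · have hd4 : (4:ℝ) ≤ d := by exact_mod_cast h4
        have h3' : 2 ≤ √(d:ℝ) := Real.le_sqrt_of_sq_le (by linarith)
        have ha : ∀ i, a i ≤ 4/3 := fun i => by
          have := hmax i
          by_contra hcon
          push Not at hcon
          nlinarith
        have hn := sumsq_le a ha0 (4/3) (by norm_num) hs ha
        refine (measureReal_mono hsub).trans ?_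
        have h := laurent_massart a (4/3) (4/3*d) x hx (by norm_num) (by positivity) ha0 ha hn
        refine le_trans (measureReal_mono fun z hz => ?_) h
        have hz : 2*(√d+1)*x ≤ YY a z := hz
        refine le_trans ?_ hz
        have : √(4/3*d*x) ≤ 0.693*√d*x := Real.sqrt_le_iff.2 ⟨by positivity, by
          rw [mul_pow, mul_pow, hsd2]
          have hdx : 0 < d * x := by positivity
          have : d * x * 2.8 ≤ d * x * x := mul_le_mul_of_nonneg_left hx2.le hdx.le
          nlinarith⟩
        nlinarith

end GEB

namespace GEB

lemma inner_dot {n : ℕ} (x y : EuclideanSpace ℝ (Fin n)) : inner ℝ x y = x.ofLp ⬝ᵥ y.ofLp := by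
  rw [EuclideanSpace.inner_eq_star_dotProduct, dotProduct_comm]; simp

lemma pars {n : ℕ} (e : OrthonormalBasis (Fin n) ℝ (EuclideanSpace ℝ (Fin n))) (v : Fin n → ℝ) :
    ∑ k, ((e k).ofLp ⬝ᵥ v)^2 = v ⬝ᵥ v := by
  have h := e.sum_inner_mul_inner (WithLp.toLp 2 v) (WithLp.toLp 2 v)
  simp only [inner_dot] at h
  rw [← h]
  refine Finset.sum_congr rfl fun k _ => ?_
  rw [dotProduct_comm v, sq]

lemma spec {n : ℕ} {S : Matrix (Fin n) (Fin n) ℝ} (hS : S.IsHermitian) (v : Fin n → ℝ) :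
    v ⬝ᵥ (S *ᵥ v) = ∑ k, hS.eigenvalues k * ((hS.eigenvectorBasis k).ofLp ⬝ᵥ v)^2 := by
  have h := hS.eigenvectorBasis.sum_inner_mul_inner (WithLp.toLp 2 (S *ᵥ v)) (WithLp.toLp 2 v)
  simp only [inner_dot] at h
  rw [dotProduct_comm, ← h]
  refine Finset.sum_congr rfl fun k _ => ?_
  have hT : Sᵀ = S := by simpa [IsHermitian, conjTranspose_eq_transpose_of_trivial] using hS
  have : (S *ᵥ v) ⬝ᵥ (hS.eigenvectorBasis k).ofLp = hS.eigenvalues k * ((hS.eigenvectorBasis k).ofLp ⬝ᵥ v) := by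
    have h2 := hS.mulVec_eigenvectorBasis k
    rw [dotProduct_comm, dotProduct_mulVec, ← mulVec_transpose, hT, h2, smul_dotProduct, smul_eq_mul]
  rw [this]; ring

lemma quad_le {n : ℕ} {S : Matrix (Fin n) (Fin n) ℝ} (hS : S.IsHermitian) (κ : ℝ)
    (h : ∀ k, hS.eigenvalues k ≤ κ) (v : Fin n → ℝ) : v ⬝ᵥ (S *ᵥ v) ≤ κ * (v ⬝ᵥ v) := by
  rw [spec hS, ← pars hS.eigenvectorBasis v, Finset.mul_sum]
  exact Finset.sum_le_sum fun k _ => mul_le_mul_of_nonneg_right (h k) (sq_nonneg _)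

lemma eig_eq {n : ℕ} {S : Matrix (Fin n) (Fin n) ℝ} (hS : S.IsHermitian) (k : Fin n) :
    ∃ v : Fin n → ℝ, v ⬝ᵥ v = 1 ∧ v ⬝ᵥ (S *ᵥ v) = hS.eigenvalues k := by
  refine ⟨(hS.eigenvectorBasis k).ofLp, ?_, ?_⟩
  · rw [← inner_dot]
    rw [real_inner_self_eq_norm_sq, hS.eigenvectorBasis.orthonormal.1 k]; norm_num
  · have h2 := hS.mulVec_eigenvectorBasis k
    rw [h2, dotProduct_smul, ← inner_dot, real_inner_self_eq_norm_sq, hS.eigenvectorBasis.orthonormal.1 k]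
    simp

lemma psd_quad {ι : Type*} [Fintype ι] {M : Matrix ι ι ℝ} (h : M.PosSemidef) (v : ι → ℝ) :
    0 ≤ v ⬝ᵥ (M *ᵥ v) := by
  have := h.dotProduct_mulVec_nonneg v
  simpa using this

lemma entry_abs {t : ℕ} {K : Matrix (Fin t) (Fin t) ℝ} (hK : K.PosSemidef) (α : ℝ)
    (hα : ∀ i j, K i j ≤ α) (i j : Fin t) : |K i j| ≤ α := by
  rw [abs_le]
  refine ⟨?_, hα i j⟩
  have h := psd_quad hK (Pi.single i 1 + Pi.single j 1)
  have hT : K j i = K i j := by simpa using hK.isHermitian.apply i j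
  rw [mulVec_add, add_dotProduct, dotProduct_add, dotProduct_add] at h
  simp [hT] at h
  linarith [hα i i, hα j j]

lemma quad_support {t : ℕ} {K : Matrix (Fin t) (Fin t) ℝ} (hK : K.PosSemidef) (α : ℝ) 
    (hα : ∀ i j, K i j ≤ α) (hα0 : 0 ≤ α) (S : Finset (Fin t)) (y : Fin t → ℝ) (hy : ∀ j ∉ S, y j = 0) :
    y ⬝ᵥ (K *ᵥ y) ≤ S.card * α * (y ⬝ᵥ y) := by
  have e1 : y ⬝ᵥ (K *ᵥ y) = ∑ i, ∑ j, y i * K i j * y j := by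
    simp only [dotProduct, mulVec, Finset.mul_sum]
    refine Finset.sum_congr rfl fun i _ => Finset.sum_congr rfl fun j _ => by ring
  have e2 : ∑ i, |y i| = ∑ i ∈ S, |y i| := by
    symm; apply Finset.sum_subset (Finset.subset_univ S)
    intro i _ hi; simp [hy i hi]
  have e3 : y ⬝ᵥ y = ∑ i ∈ S, |y i|^2 := by
    simp only [dotProduct]
    symm
    rw [Finset.sum_subset (Finset.subset_univ S)]
    · refine Finset.sum_congr rfl fun i _ => by rw [sq_abs, sq]
    · intro i _ hi; simp [hy i hi]
  calc y ⬝ᵥ (K *ᵥ y) ≤ ∑ i, ∑ j, |y i| * α * |y j| := by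
        rw [e1]
        refine Finset.sum_le_sum fun i _ => Finset.sum_le_sum fun j _ => ?_
        refine (le_abs_self _).trans ?_
        rw [abs_mul, abs_mul]
        gcongr
        exact entry_abs hK α hα i j
    _ = α * (∑ i, |y i|)^2 := by
        rw [sq, Finset.sum_mul_sum, Finset.mul_sum]
        refine Finset.sum_congr rfl fun i _ => ?_
        rw [Finset.mul_sum]
        refine Finset.sum_congr rfl fun j _ => by ring
    _ ≤ α * (S.card * ∑ i ∈ S, |y i|^2) := by
        rw [e2]; gcongr; exact sq_sum_le_card_mul_sum_sq
    _ = _ := by rw [e3]; ring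

lemma inv_lower {t : ℕ} {M : Matrix (Fin t) (Fin t) ℝ} (hM : M.PosDef) (b y : Fin t → ℝ) (τ : ℝ) :
    2*τ*(b ⬝ᵥ y) - τ^2 * (y ⬝ᵥ (M *ᵥ y)) ≤ b ⬝ᵥ (M⁻¹ *ᵥ b) := by
  have hT : Mᵀ = M := by simpa [IsHermitian, conjTranspose_eq_transpose_of_trivial] using hM.isHermitian
  have hdet : IsUnit M.det := (Matrix.isUnit_iff_isUnit_det M).1 hM.isUnit
  set w := M⁻¹ *ᵥ b with hw
  have hMw : M *ᵥ w = b := by rw [hw, mulVec_mulVec, mul_nonsing_inv _ hdet, one_mulVec]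
  have h := psd_quad hM.posSemidef (w - τ • y)
  have h2 : w ⬝ᵥ (M *ᵥ y) = b ⬝ᵥ y := by
    rw [dotProduct_mulVec, ← mulVec_transpose, hT, hMw]
  rw [mulVec_sub, mulVec_smul, hMw, sub_dotProduct, dotProduct_sub, dotProduct_sub] at h
  simp only [dotProduct_smul, smul_dotProduct, smul_eq_mul, h2] at h
  rw [dotProduct_comm y b, dotProduct_comm w b] at h
  linarith

variable {d t : ℕ} (σ κ α β : ℝ)
    (A : Matrix (Fin d) (Fin d) ℝ) (B : Matrix (Fin d) (Fin t) ℝ) (K : Matrix (Fin t) (Fin t) ℝ)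

lemma M_posDef (hσ : 0 < σ) (hK : K.PosSemidef) : (K + σ ^ 2 • (1 : Matrix (Fin t) (Fin t) ℝ)).PosDef :=
  Matrix.PosDef.posSemidef_add hK (Matrix.PosDef.one.smul (by positivity))

lemma trace_lower (hσ : 0 < σ) (hα : 0 ≤ α) (hK : K.PosSemidef) (hKα : ∀ i j, K i j ≤ α)
    (S : Finset (Fin t)) (hS : S.Nonempty) (hB : ∀ j ∈ S, β ≤ ∑ i, (B i j) ^ 2) :
    β / (α + σ^2 / S.card) ≤ (B * (K + σ ^ 2 • (1 : Matrix (Fin t) (Fin t) ℝ))⁻¹ * Bᵀ).trace := by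
  have hM := M_posDef σ K hσ hK
  have hN : (0:ℝ) < S.card := by exact_mod_cast hS.card_pos
  set N : ℝ := (S.card : ℝ)
  have hden : 0 < N * α + σ^2 := by positivity
  set τ := 1/(N*α+σ^2) with hτ
  have hτ0 : 0 < τ := by positivity
  have hτ1 : τ * (N*α+σ^2) = 1 := by rw [hτ]; field_simp
  have hrow : ∀ i, τ * ∑ j ∈ S, (B i j)^2 ≤
      B i ⬝ᵥ ((K + σ ^ 2 • (1 : Matrix (Fin t) (Fin t) ℝ))⁻¹ *ᵥ B i) := by
    intro i
    set y : Fin t → ℝ := fun j => if j ∈ S then B i j else 0 with hy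
    have h1 := inv_lower hM (B i) y τ
    have hby : B i ⬝ᵥ y = ∑ j ∈ S, (B i j)^2 := by
      simp [dotProduct, hy, sq]
    have hyy : y ⬝ᵥ y = ∑ j ∈ S, (B i j)^2 := by
      simp [dotProduct, hy, sq]
    have h2 := quad_support hK α hKα hα S y (fun j hj => by simp [hy, hj])
    rw [add_mulVec, dotProduct_add, smul_mulVec, one_mulVec, dotProduct_smul, smul_eq_mul] at h1
    rw [hyy] at h1 h2
    rw [hby] at h1
    set n := ∑ j ∈ S, (B i j)^2
    refine le_trans ?_ h1
    have h3 : τ^2 * (y ⬝ᵥ K *ᵥ y + σ^2 * n) ≤ τ^2 * (N*α*n + σ^2*n) := by gcongr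
    have h4 : τ^2 * (N*α*n + σ^2*n) = τ * n := by
      calc _ = (τ * (N*α+σ^2)) * τ * n := by ring
        _ = _ := by rw [hτ1, one_mul]
    linarith
  have htr : (B * (K + σ ^ 2 • (1 : Matrix (Fin t) (Fin t) ℝ))⁻¹ * Bᵀ).trace =
      ∑ i, B i ⬝ᵥ ((K + σ ^ 2 • (1 : Matrix (Fin t) (Fin t) ℝ))⁻¹ *ᵥ B i) := by
    rw [trace]
    refine Finset.sum_congr rfl fun i _ => ?_
    rw [diag_apply, Matrix.mul_assoc, mul_apply, dotProduct]
    refine Finset.sum_congr rfl fun j _ => ?_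
    rfl
  rw [htr]
  refine le_trans ?_ (Finset.sum_le_sum fun i _ => hrow i)
  rw [← Finset.mul_sum, Finset.sum_comm]
  have h5 : N * β ≤ ∑ j ∈ S, ∑ i, (B i j)^2 := by
    have := Finset.card_nsmul_le_sum S (fun j => ∑ i, (B i j)^2) β hB
    rwa [nsmul_eq_mul] at this
  calc β / (α + σ^2 / N) = τ * (N * β) := by rw [hτ]; field_simp
    _ ≤ _ := mul_le_mul_of_nonneg_left h5 hτ0.le

lemma beta_le (hA : A.IsHermitian) (hAκ : ∀ k, hA.eigenvalues k ≤ κ) (hκ : 0 ≤ κ) (hα : 0 ≤ α)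
    (hKα : ∀ i j, K i j ≤ α) (hblk : (Matrix.fromBlocks A B Bᵀ K).PosSemidef)
    (j : Fin t) (hB : β ≤ ∑ i, (B i j) ^ 2) : β ≤ α * κ := by
  set n := ∑ i, (B i j) ^ 2 with hn
  have hn0 : 0 ≤ n := by positivity
  have hq : ∀ ξ : ℝ, 0 ≤ α * (ξ * ξ) + (2*n) * ξ + κ * n := by
    intro ξ
    have h := psd_quad hblk (Sum.elim (fun i => B i j) (Pi.single j ξ))
    rw [fromBlocks_mulVec, sumElim_dotProduct_sumElim] at h
    simp only [Sum.elim_comp_inl, Sum.elim_comp_inr, dotProduct_add] at h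
    have h1 := quad_le hA κ hAκ (fun i => B i j)
    have e1 : (fun i => B i j) ⬝ᵥ (fun i => B i j) = n := by simp [dotProduct, hn, sq]
    have e2 : (fun i => B i j) ⬝ᵥ (B *ᵥ Pi.single j ξ) = ξ * n := by
      simp only [dotProduct, mulVec_single, hn, Finset.mul_sum]
      refine Finset.sum_congr rfl fun i _ => ?_
      simp; ring
    have e3 : Pi.single j ξ ⬝ᵥ (Bᵀ *ᵥ fun i => B i j) = ξ * n := by
      rw [single_dotProduct]; simp [mulVec, dotProduct, hn, sq]
    have e4 : Pi.single j ξ ⬝ᵥ (K *ᵥ Pi.single j ξ) = ξ * ξ * K j j := by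
      rw [single_dotProduct]; simp; ring
    rw [e1] at h1
    rw [e2, e3, e4] at h
    nlinarith [mul_le_mul_of_nonneg_left (hKα j j) (mul_self_nonneg ξ)]
  have hd := discrim_le_zero hq
  rw [discrim] at hd
  rcases hn0.eq_or_lt with h | h
  · rw [← h] at hB; exact hB.trans (by positivity)
  · refine hB.trans ?_
    by_contra hcon
    push Not at hcon
    nlinarith

end GEB

namespace GEB

/-- the diagonalising map -/
noncomputable def diagMap {d : ℕ} (e : OrthonormalBasis (Fin d) ℝ (EuclideanSpace ℝ (Fin d)))
    (lam : Fin d → ℝ) (m : EuclideanSpace ℝ (Fin d)) (z : Fin d → ℝ) : EuclideanSpace ℝ (Fin d) :=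
  m + e.repr.symm (WithLp.toLp 2 (fun i => √(lam i) * z i))

variable {d : ℕ} (e : OrthonormalBasis (Fin d) ℝ (EuclideanSpace ℝ (Fin d)))
    (lam : Fin d → ℝ) (m : EuclideanSpace ℝ (Fin d))

lemma diagMap_meas : Measurable (diagMap e lam m) := by
  have h1 : Measurable (fun z : Fin d → ℝ => (WithLp.toLp 2 (fun i => √(lam i) * z i) : EuclideanSpace ℝ (Fin d))) :=
    (WithLp.measurable_toLp 2 _).comp (by fun_prop)
  exact (e.repr.symm.continuous.measurable.comp h1).const_add m

lemma diagMap_norm (h : ∀ i, 0 ≤ lam i) (z : Fin d → ℝ) :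
    ‖diagMap e lam m z - m‖^2 = ∑ i, lam i * z i ^2 := by
  rw [diagMap, add_sub_cancel_left, LinearIsometryEquiv.norm_map, EuclideanSpace.norm_sq_eq]
  refine Finset.sum_congr rfl fun i _ => ?_
  rw [Real.norm_eq_abs, sq_abs, mul_pow, Real.sq_sqrt (h i)]

lemma diagMap_inner (z : Fin d → ℝ) (u : EuclideanSpace ℝ (Fin d)) :
    inner ℝ (diagMap e lam m z) u = m.ofLp ⬝ᵥ u.ofLp + ∑ i, (√(lam i) * ((e i).ofLp ⬝ᵥ u.ofLp)) * z i := by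
  rw [diagMap, inner_add_left, inner_dot m u, LinearIsometryEquiv.inner_map_eq_flip, inner_dot]
  congr 1
  simp only [dotProduct, LinearIsometryEquiv.symm_symm]
  refine Finset.sum_congr rfl fun i _ => ?_
  rw [OrthonormalBasis.repr_apply_apply, inner_dot, dotProduct]
  ring

lemma charFun_diag (h : ∀ i, 0 ≤ lam i) (u : EuclideanSpace ℝ (Fin d)) :
    charFun ((gpi d).map (diagMap e lam m)) u =
      Complex.exp (((m.ofLp ⬝ᵥ u.ofLp : ℝ):ℂ) * Complex.I -
        ((∑ i, lam i * ((e i).ofLp ⬝ᵥ u.ofLp)^2 : ℝ) : ℂ)/2) := by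
  rw [charFun_apply, integral_map (diagMap_meas e lam m).aemeasurable (by fun_prop)]
  have h1 : ∀ z : Fin d → ℝ, Complex.exp (((inner ℝ (diagMap e lam m z) u : ℝ) : ℂ) * Complex.I) =
      Complex.exp (((m.ofLp ⬝ᵥ u.ofLp : ℝ):ℂ) * Complex.I) *
      ∏ i, Complex.exp (((√(lam i) * ((e i).ofLp ⬝ᵥ u.ofLp) : ℝ) : ℂ) * ((z i : ℝ) : ℂ) * Complex.I) := by
    intro z
    rw [diagMap_inner, ← Complex.exp_sum, ← Complex.exp_add]
    congr 1
    push_cast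
    rw [add_mul, Finset.sum_mul]
  simp_rw [h1]
  rw [integral_const_mul, integral_fintype_prod_eq_prod (fun i (x:ℝ) =>
    Complex.exp (((√(lam i) * ((e i).ofLp ⬝ᵥ u.ofLp) : ℝ) : ℂ) * ((x : ℝ) : ℂ) * Complex.I))]
  simp_rw [← charFun_apply_real, charFun_gaussianReal]
  rw [← Complex.exp_sum, ← Complex.exp_add]
  congr 1
  rw [sub_eq_add_neg]
  congr 1
  rw [Complex.ofReal_sum, Finset.sum_div, ← Finset.sum_neg_distrib]
  refine Finset.sum_congr rfl fun i _ => ?_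
  have : ((√(lam i) * ((e i).ofLp ⬝ᵥ u.ofLp) : ℝ) : ℂ)^2 = ((lam i * ((e i).ofLp ⬝ᵥ u.ofLp)^2 : ℝ) : ℂ) := by
    rw [← Complex.ofReal_pow, mul_pow, Real.sq_sqrt (h i)]
  rw [this]
  simp

lemma law {Ω : Type} [MeasurableSpace Ω] (P : Measure Ω) [IsProbabilityMeasure P]
    (X : Ω → EuclideanSpace ℝ (Fin d)) (m : EuclideanSpace ℝ (Fin d))
    (S : Matrix (Fin d) (Fin d) ℝ) (hS : S.PosSemidef)
    (hX : ∀ u : Fin d → ℝ,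
      P.map (fun w => ∑ i, u i * X w i) =
        gaussianReal (∑ i, u i * m i)
          (Real.toNNReal (∑ i, ∑ j, u i * S i j * u j))) :
    AEMeasurable X P ∧
    P.map X = (gpi d).map (diagMap hS.isHermitian.eigenvectorBasis hS.isHermitian.eigenvalues m) := by
  have hm : ∀ u : Fin d → ℝ, AEMeasurable (fun w => ∑ i, u i * X w i) P := fun u => by
    apply AEMeasurable.of_map_ne_zero
    rw [hX u]; exact IsProbabilityMeasure.ne_zero _
  have hXm : AEMeasurable X P := by
    have h1 : AEMeasurable (fun w => (X w).ofLp) P := by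
      rw [aemeasurable_pi_iff]
      intro i
      simpa [Pi.single_apply] using hm (Pi.single i 1)
    exact (WithLp.measurable_toLp 2 _).comp_aemeasurable h1
  refine ⟨hXm, ?_⟩
  have := Measure.isProbabilityMeasure_map (μ := P) hXm
  have := Measure.isProbabilityMeasure_map (μ := gpi d) (diagMap_meas hS.isHermitian.eigenvectorBasis hS.isHermitian.eigenvalues m).aemeasurable
  apply Measure.ext_of_charFun
  ext u
  rw [charFun_diag _ _ _ hS.eigenvalues_nonneg, ← spec hS.isHermitian]
  rw [charFun_apply, integral_map hXm (by fun_prop)]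
  have h2 : ∀ w, Complex.exp (((inner ℝ (X w) u : ℝ) : ℂ) * Complex.I) =
      Complex.exp (((1:ℝ):ℂ) * ((∑ i, u i * X w i : ℝ) : ℂ) * Complex.I) := by
    intro w
    rw [inner_dot, dotProduct_comm, Complex.ofReal_one, one_mul]; rfl
  simp_rw [h2]
  have h3 := charFun_gaussianReal (μ := ∑ i, u i * m i) (v := (Real.toNNReal (∑ i, ∑ j, u i * S i j * u j))) 1
  rw [← hX u, charFun_apply_real, integral_map (hm _) (by fun_prop)] at h3
  rw [h3]
  have e1 : ∑ i, ∑ j, u i * S i j * u j = u.ofLp ⬝ᵥ (S *ᵥ u.ofLp) := by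
    simp only [dotProduct, mulVec, Finset.mul_sum]
    refine Finset.sum_congr rfl fun i _ => Finset.sum_congr rfl fun j _ => by ring
  rw [e1, Real.coe_toNNReal _ (psd_quad hS _)]
  have e2 : ∑ i, u i * m i = m.ofLp ⬝ᵥ u.ofLp := by rw [dotProduct_comm]; rfl
  rw [e2]
  simp

lemma prob_bound (hd : 1 ≤ d) (lam : Fin d → ℝ) (h0 : ∀ i, 0 ≤ lam i) (κ c : ℝ)
    (hκ : ∀ i, lam i ≤ κ) (hc0 : 0 ≤ c) (hc : c ≤ κ) (htr : ∑ i, lam i ≤ d * κ - c) (x : ℝ) (hx : 0 < x) :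
    (gpi d).real {z | ((d:ℝ) + 2*(√d+1)*x) * (κ - c/d) < ∑ i, lam i * z i ^2} ≤ Real.exp (-x) := by
  have hdR : (1:ℝ) ≤ d := by exact_mod_cast hd
  set ν := κ - c/d with hν
  have hdν : d * ν = d * κ - c := by rw [hν]; field_simp
  have hκ1 : (d-1) * κ ≤ d * ν := by linarith
  have hκ0 : 0 ≤ κ := hc0.trans hc
  have hν0 : 0 ≤ ν := by
    have : 0 ≤ (d:ℝ) * ν := le_trans (by apply mul_nonneg <;> linarith) hκ1
    exact nonneg_of_mul_nonneg_right this (by linarith)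
  rcases hν0.eq_or_lt with hz | hpos
  · have hs : ∑ i, lam i = 0 := le_antisymm (by rw [← hdν, ← hz] at htr; linarith) (Finset.sum_nonneg fun i _ => h0 i)
    have hl : ∀ i, lam i = 0 := fun i => (Finset.sum_eq_zero_iff_of_nonneg (fun i _ => h0 i)).1 hs i (Finset.mem_univ i)
    have : {z : Fin d → ℝ | ((d:ℝ) + 2*(√d+1)*x) * ν < ∑ i, lam i * z i ^2} = ∅ := by
      ext z; simp [hl, ← hz]
    rw [this, measureReal_empty]; exact (Real.exp_pos _).le
  · refine le_trans (measureReal_mono ?_) (core hd (fun i => lam i / ν) (fun i => div_nonneg (h0 i) hpos.le) ?_ ?_ x hx)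
    · intro z hz
      have hz : ((d:ℝ) + 2*(√d+1)*x) * ν < ∑ i, lam i * z i ^2 := hz
      change (d:ℝ) + 2*(√d+1)*x < ∑ i, lam i / ν * z i ^2
      have : ∑ i, lam i / ν * z i ^2 = (∑ i, lam i * z i ^2) / ν := by
        rw [Finset.sum_div]; refine Finset.sum_congr rfl fun i _ => by ring
      rw [this, lt_div_iff₀ hpos]; exact hz
    · rw [← Finset.sum_div, div_le_iff₀ hpos, hdν]; exact htr
    · intro i
      rw [← mul_div_assoc, div_le_iff₀ hpos]
      exact le_trans (mul_le_mul_of_nonneg_left (hκ i) (by linarith)) hκ1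

end GEB

/-- Proposition 1 of the paper in concrete matrix–Gaussian form: with `λ_max(A) ≤ κ`, entries
of `K` at most `α`, PSD block matrix `[[A, B], [Bᵀ, K]]`, a nonempty subset `S` of `N` columns
of `B` each of squared norm at least `β`, and `X` a multivariate Gaussian in `ℝ^d` with mean
`m` and covariance `Σ = A − B (K + σ²I)⁻¹ Bᵀ`, for every `δ ∈ (0,1)`, with probability at
least `1 − δ`, `‖X − m‖² ≤ ω·κ − (ω·β/d)/(α + σ²/N)` where `ω = d + 2(√d + 1)·ln(1/δ)`. -/
theorem gradient_estimation_error_bound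
    (d t : ℕ) (hd : 1 ≤ d) (ht : 1 ≤ t) (σ κ α β : ℝ)
    (hσ : 0 < σ) (hκ : 0 ≤ κ) (hα : 0 ≤ α) (hβ : 0 ≤ β)
    (A : Matrix (Fin d) (Fin d) ℝ) (hA : A.IsHermitian)
    (hAκ : ⨆ i, hA.eigenvalues i ≤ κ)
    (B : Matrix (Fin d) (Fin t) ℝ)
    (K : Matrix (Fin t) (Fin t) ℝ) (hK : K.IsHermitian)
    (hKα : ∀ i j, K i j ≤ α)
    (hblk : (Matrix.fromBlocks A B Bᵀ K).PosSemidef)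
    (S : Finset (Fin t)) (N : ℕ) (hS : S.Nonempty) (hN : S.card = N)
    (hB : ∀ j ∈ S, β ≤ ∑ i, (B i j) ^ 2)
    (hSigma : (A - B * (K + σ ^ 2 • (1 : Matrix (Fin t) (Fin t) ℝ))⁻¹ * Bᵀ).PosSemidef)
    {Ω : Type} [MeasurableSpace Ω] (P : Measure Ω) [IsProbabilityMeasure P]
    (X : Ω → EuclideanSpace ℝ (Fin d)) (m : EuclideanSpace ℝ (Fin d))
    (hX : ∀ u : Fin d → ℝ,
      P.map (fun w => ∑ i, u i * X w i) =
        gaussianReal (∑ i, u i * m i)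
          (Real.toNNReal (∑ i, ∑ j,
            u i * (A - B * (K + σ ^ 2 • (1 : Matrix (Fin t) (Fin t) ℝ))⁻¹ * Bᵀ) i j * u j)))
    (δ : ℝ) (hδ : δ ∈ Set.Ioo (0 : ℝ) 1) :
    ENNReal.ofReal (1 - δ) ≤
      P {w | ‖X w - m‖ ^ 2 ≤
        ((d : ℝ) + 2 * (Real.sqrt d + 1) * Real.log (1 / δ)) * κ -
          (((d : ℝ) + 2 * (Real.sqrt d + 1) * Real.log (1 / δ)) * β / d) /
            (α + σ ^ 2 / N)} := by
  have hK' : K.PosSemidef := hblk.submatrix Sum.inr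
  have hM := GEB.M_posDef σ K hσ hK'
  have heig : ∀ k, hA.eigenvalues k ≤ κ := fun k =>
    (le_ciSup (Set.finite_range _).bddAbove k).trans hAκ
  have hdR : (1:ℝ) ≤ d := by exact_mod_cast hd
  have hNpos : (0:ℝ) < N := by rw [← hN]; exact_mod_cast hS.card_pos
  have hden : 0 < α + σ ^ 2 / N := by positivity
  have htrl := GEB.trace_lower σ α β B K hσ hα hK' hKα S hS hB
  rw [hN] at htrl
  obtain ⟨j, hj⟩ := hS
  have hbl := GEB.beta_le κ α β A B K hA heig hκ hα hKα hblk j (hB j hj)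
  set c := β / (α + σ ^ 2 / N) with hc
  have hc0 : 0 ≤ c := by positivity
  have hcκ : c ≤ κ := by
    rw [hc, div_le_iff₀ hden]
    have : 0 ≤ κ * (σ ^ 2 / N) := by positivity
    linarith
  set M := K + σ ^ 2 • (1 : Matrix (Fin t) (Fin t) ℝ) with hMdef
  set Sg := A - B * M⁻¹ * Bᵀ with hSg
  have hlamκ : ∀ i, hSigma.isHermitian.eigenvalues i ≤ κ := by
    intro i
    obtain ⟨v, hv1, hv2⟩ := GEB.eig_eq hSigma.isHermitian i
    rw [← hv2]
    have h1 := GEB.quad_le hA κ heig v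
    rw [hv1, mul_one] at h1
    have h2 := GEB.psd_quad hM.inv.posSemidef (Bᵀ *ᵥ v)
    have h3 : v ⬝ᵥ ((B * M⁻¹ * Bᵀ) *ᵥ v) = (Bᵀ *ᵥ v) ⬝ᵥ (M⁻¹ *ᵥ (Bᵀ *ᵥ v)) := by
      rw [← mulVec_mulVec, ← mulVec_mulVec, dotProduct_mulVec, ← mulVec_transpose]
    rw [hSg, sub_mulVec, dotProduct_sub, h3]
    linarith
  have htrA : A.trace ≤ d * κ := by
    rw [hA.trace_eq_sum_eigenvalues]
    calc _ ≤ ∑ i : Fin d, κ := Finset.sum_le_sum fun i _ => heig i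
      _ = _ := by simp
  have htr : ∑ i, hSigma.isHermitian.eigenvalues i ≤ d * κ - c := by
    have h := hSigma.isHermitian.trace_eq_sum_eigenvalues
    have h' : Sg.trace = A.trace - (B * M⁻¹ * Bᵀ).trace := by rw [hSg, trace_sub]
    have h'' : Sg.trace = ∑ i, hSigma.isHermitian.eigenvalues i := h
    linarith
  obtain ⟨hδ0, hδ1⟩ := hδ
  have hx : 0 < Real.log (1 / δ) := Real.log_pos (by rw [lt_div_iff₀ hδ0]; linarith)
  have hex : Real.exp (-Real.log (1 / δ)) = δ := by
    rw [one_div, Real.log_inv, neg_neg, Real.exp_log hδ0]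
  have hmain := GEB.prob_bound hd _ hSigma.eigenvalues_nonneg κ c hlamκ hc0 hcκ htr _ hx
  rw [hex] at hmain
  obtain ⟨hXm, hlaw⟩ := GEB.law P X m Sg hSigma hX
  have hT : ((d : ℝ) + 2 * (Real.sqrt d + 1) * Real.log (1 / δ)) * κ -
      (((d : ℝ) + 2 * (Real.sqrt d + 1) * Real.log (1 / δ)) * β / d) / (α + σ ^ 2 / N) =
      ((d : ℝ) + 2 * (Real.sqrt d + 1) * Real.log (1 / δ)) * (κ - c / d) := by
    rw [hc]; field_simp
  rw [hT]
  set T := ((d : ℝ) + 2 * (Real.sqrt d + 1) * Real.log (1 / δ)) * (κ - c / d)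
  have hE : MeasurableSet {y : EuclideanSpace ℝ (Fin d) | ‖y - m‖ ^ 2 ≤ T} :=
    measurableSet_le (by fun_prop) (by fun_prop)
  have hP : P {w | ‖X w - m‖ ^ 2 ≤ T} =
      (GEB.gpi d) {z | ∑ i, hSigma.isHermitian.eigenvalues i * z i ^ 2 ≤ T} := by
    have h1 := Measure.map_apply_of_aemeasurable hXm hE
    rw [hlaw, Measure.map_apply (GEB.diagMap_meas _ _ _) hE] at h1
    refine (h1.symm.trans ?_)
    congr 1
    ext z
    simp only [Set.mem_preimage, Set.mem_ofPred_eq]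
    rw [GEB.diagMap_norm _ _ _ hSigma.eigenvalues_nonneg]
  rw [hP]
  have hcompl : {z : Fin d → ℝ | ∑ i, hSigma.isHermitian.eigenvalues i * z i ^ 2 ≤ T} =
      {z | T < ∑ i, hSigma.isHermitian.eigenvalues i * z i ^ 2}ᶜ := by
    ext z; simp
  have hmeas : MeasurableSet {z : Fin d → ℝ | T < ∑ i, hSigma.isHermitian.eigenvalues i * z i ^ 2} :=
    measurableSet_lt (by fun_prop) (by fun_prop)
  rw [hcompl, ← ENNReal.ofReal_toReal (measure_ne_top (GEB.gpi d) _)]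
  apply ENNReal.ofReal_le_ofReal
  have h := probReal_compl_eq_one_sub (μ := GEB.gpi d) hmeas
  rw [Measure.real] at h
  rw [h]
  linarith
end
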